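/- arXiv:1903.02626 — 11 statements merged into one kernel-verified Lean document; each statement's English description precedes it below -/
import Mathlib

section
/- For every choice of f_1,…,f_N ∈ A, the operator d commutes with the operator η on A ⊗_K Λ(K^N), i.e. d ∘ η = η ∘ d. In other words, each map d_k : A ⊗ Λ^k(K^N) → A ⊗ Λ^{k+1}(K^N) is a morphism for the action of vector fields. -/
open TensorProduct

/-- A derivation of the exterior algebra sending `e_j` to `δ_{ij} e_p` sends `ι m` to
`m_i e_p`. -/
theorem map_ι_of_map_ι_single {K : Type*} [Field K] {N : ℕ} {p i : Fin N}
    {E : ExteriorAlgebra K (Fin N → K) →ₗ[K] ExteriorAlgebra K (Fin N → K)}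
    (hE : ∀ j, E (ExteriorAlgebra.ι K (Pi.single j 1))
      = if i = j then ExteriorAlgebra.ι K (Pi.single p 1) else 0) (m : Fin N → K) :
    E (ExteriorAlgebra.ι K m) = m i • ExteriorAlgebra.ι K (Pi.single p 1) := by
  conv_lhs => rw [pi_eq_sum_univ' m]
  simp [hE]

/-- If `E` and `E'` are derivations of the exterior algebra sending `e_j` to `δ_{ij} e_p` and
`δ_{ij} e_q` respectively, then `e_q ∧ E w` and `e_p ∧ E' w` are opposite. -/
theorem ι_single_mul_map_eq_neg {K : Type*} [Field K] {N : ℕ} {p q i : Fin N}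
    {E E' : ExteriorAlgebra K (Fin N → K) →ₗ[K] ExteriorAlgebra K (Fin N → K)}
    (hL : ∀ v w, E (v * w) = E v * w + v * E w)
    (hL' : ∀ v w, E' (v * w) = E' v * w + v * E' w)
    (hE : ∀ j, E (ExteriorAlgebra.ι K (Pi.single j 1))
      = if i = j then ExteriorAlgebra.ι K (Pi.single p 1) else 0)
    (hE' : ∀ j, E' (ExteriorAlgebra.ι K (Pi.single j 1))
      = if i = j then ExteriorAlgebra.ι K (Pi.single q 1) else 0)
    (w : ExteriorAlgebra K (Fin N → K)) :
    ExteriorAlgebra.ι K (Pi.single q 1) * E w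
      = -(ExteriorAlgebra.ι K (Pi.single p 1) * E' w) := by
  have anticomm (x y : Fin N → K) :
      ExteriorAlgebra.ι K x * ExteriorAlgebra.ι K y
        = -(ExteriorAlgebra.ι K y * ExteriorAlgebra.ι K x) :=
    eq_neg_of_add_eq_zero_left (ExteriorAlgebra.ι_add_mul_swap x y)
  induction w using CliffordAlgebra.left_induction with
  | algebraMap r =>
    have h1 : E 1 = 0 := by simpa using hL 1 1
    have h1' : E' 1 = 0 := by simpa using hL' 1 1
    simp [Algebra.algebraMap_eq_smul_one, h1, h1']
  | add x y hx hy => rw [map_add, map_add, mul_add, mul_add, hx, hy, neg_add]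
  | ι_mul x m hx =>
    change _ * E (ExteriorAlgebra.ι K m * x) = -(_ * E' (ExteriorAlgebra.ι K m * x))
    rw [hL, hL', map_ι_of_map_ι_single hE, map_ι_of_map_ι_single hE', mul_add, mul_add,
      smul_mul_assoc, smul_mul_assoc, mul_smul_comm, mul_smul_comm, ← mul_assoc, ← mul_assoc,
      ← mul_assoc, ← mul_assoc, anticomm (Pi.single q 1) m, anticomm (Pi.single p 1) m,
      anticomm (Pi.single q 1) (Pi.single p 1), neg_mul, neg_mul, neg_mul, mul_assoc _ _ (E x),
      mul_assoc _ _ (E' x), hx, mul_neg, smul_neg, neg_add]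

/-- Pairing a symmetric family with an antisymmetric one gives zero. -/
theorem sum_tmul_eq_zero_of_symm_of_antisymm {K ι M M' : Type*} [Field K] [CharZero K]
    [Fintype ι] [AddCommGroup M] [Module K M] [AddCommGroup M'] [Module K M']
    {S : ι → ι → M} {X : ι → ι → M'} (hS : ∀ p q, S p q = S q p)
    (hX : ∀ p q, X p q = -X q p) : ∑ p, ∑ q, S p q ⊗ₜ[K] X p q = 0 := by
  have h : ∑ p, ∑ q, S p q ⊗ₜ[K] X p q = -∑ p, ∑ q, S p q ⊗ₜ[K] X p q := by
    conv_lhs => rw [Finset.sum_comm]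
    simp_rw [← Finset.sum_neg_distrib, ← TensorProduct.tmul_neg]
    exact Finset.sum_congr rfl fun p _ => Finset.sum_congr rfl fun q _ => by
      rw [hS q p, hX q p]
  exact (smul_eq_zero.1 ((two_smul K _).trans (eq_neg_iff_add_eq_zero.1 h))).resolve_left
    two_ne_zero

/-- With notation as in the de Rham complex of a gauge module: `d` defined by
`d(g ⊗ w) = Σ_p (∂_p(g) + B_p g) ⊗ (e_p ∧ w)`, and the action of the vector field
`η = Σ_i f_i ∂_i` given by
`η(g ⊗ w) = Σ_i f_i ∂_i(g) ⊗ w + Σ_i f_i B_i g ⊗ w + Σ_{i,p} ∂_p(f_i) g ⊗ E_{pi}(w)`,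
where `E_{pi}` is the degree-zero derivation of `Λ(K^N)` with `E_{pi}(e_j) = δ_{ij} e_p`,
the operator `d` commutes with `η`, i.e. `d ∘ η = η ∘ d`. -/
theorem deRham_d_comm_eta (K : Type*) [Field K] [CharZero K] (N : ℕ)
    (A : Type*) [CommRing A] [Algebra K A]
    (D : Fin N → Derivation K A A)
    (hDcomm : ∀ i j a, D i (D j a) = D j (D i a))
    (B : Fin N → A) (hB : ∀ i j, D i (B j) = D j (B i))
    (d : A ⊗[K] ExteriorAlgebra K (Fin N → K) →ₗ[K]
          A ⊗[K] ExteriorAlgebra K (Fin N → K))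
    (hd : ∀ (g : A) (w : ExteriorAlgebra K (Fin N → K)),
        d (g ⊗ₜ[K] w)
          = ∑ p : Fin N,
              (D p g + B p * g) ⊗ₜ[K] (ExteriorAlgebra.ι K (Pi.single p 1) * w))
    (E : Fin N → Fin N →
          (ExteriorAlgebra K (Fin N → K) →ₗ[K] ExteriorAlgebra K (Fin N → K)))
    (hELeibniz : ∀ p i v w, E p i (v * w) = E p i v * w + v * E p i w)
    (hEBasis : ∀ p i j,
        E p i (ExteriorAlgebra.ι K (Pi.single j 1))
          = if i = j then ExteriorAlgebra.ι K (Pi.single p 1) else 0)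
    (f : Fin N → A)
    (η : A ⊗[K] ExteriorAlgebra K (Fin N → K) →ₗ[K]
          A ⊗[K] ExteriorAlgebra K (Fin N → K))
    (hη : ∀ (g : A) (w : ExteriorAlgebra K (Fin N → K)),
        η (g ⊗ₜ[K] w)
          = ∑ i : Fin N, (f i * D i g) ⊗ₜ[K] w
            + ∑ i : Fin N, (f i * B i * g) ⊗ₜ[K] w
            + ∑ i : Fin N, ∑ p : Fin N, (D p (f i) * g) ⊗ₜ[K] (E p i w)) :
    d ∘ₗ η = η ∘ₗ d := by
  refine TensorProduct.ext' fun g w => ?_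
  have symm : ∑ i, ∑ p, ∑ q, (D q (D p (f i)) * g) ⊗ₜ[K]
      (ExteriorAlgebra.ι K (Pi.single q 1) * E p i w) = 0 :=
    Finset.sum_eq_zero fun i _ => sum_tmul_eq_zero_of_symm_of_antisymm
      (fun p q => by rw [hDcomm]) fun p q =>
        ι_single_mul_map_eq_neg (hELeibniz p i) (hELeibniz q i) (hEBasis p i) (hEBasis q i) w
  have contract : ∑ q, ∑ i, ∑ p, (D p (f i) * (D q g + B q * g)) ⊗ₜ[K]
      (E p i (ExteriorAlgebra.ι K (Pi.single q 1)) * w)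
        = ∑ i, ∑ q, (D q (f i) * (D i g + B i * g)) ⊗ₜ[K]
          (ExteriorAlgebra.ι K (Pi.single q 1) * w) := by
    rw [Finset.sum_comm]
    refine Finset.sum_congr rfl fun i _ => ?_
    rw [Finset.sum_comm]
    refine Finset.sum_congr rfl fun p _ => ?_
    simp [hEBasis, ite_mul, TensorProduct.tmul_ite]
  have commute (i q : Fin N) : D q (f i * D i g) + B q * (f i * D i g)
      + (D q (f i * B i * g) + B q * (f i * B i * g))
        = D q (f i) * (D i g + B i * g)
          + (f i * D i (D q g + B q * g) + f i * B i * (D q g + B q * g)) := by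
    simp only [Derivation.leibniz, smul_eq_mul, map_add, hDcomm q i g, hB q i]
    ring
  have expand (i p q : Fin N) : D q (D p (f i) * g) + B q * (D p (f i) * g)
      = D q (D p (f i)) * g + D p (f i) * (D q g + B q * g) := by
    simp only [Derivation.leibniz, smul_eq_mul]
    ring
  have dη : d (η (g ⊗ₜ w)) =
      ∑ i, ∑ q, (D q (f i) * (D i g + B i * g)) ⊗ₜ[K] (ExteriorAlgebra.ι K (Pi.single q 1) * w)
        + (∑ i, ∑ q, (f i * D i (D q g + B q * g)) ⊗ₜ[K]
            (ExteriorAlgebra.ι K (Pi.single q 1) * w)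
          + ∑ i, ∑ q, (f i * B i * (D q g + B q * g)) ⊗ₜ[K]
            (ExteriorAlgebra.ι K (Pi.single q 1) * w))
        + ∑ i, ∑ p, ∑ q, (D p (f i) * (D q g + B q * g)) ⊗ₜ[K]
          (ExteriorAlgebra.ι K (Pi.single q 1) * E p i w) := by
    simp only [hη, map_add d, map_sum, hd]
    refine congrArg₂ (· + ·) ?_ ?_
    · simp only [← Finset.sum_add_distrib, ← TensorProduct.add_tmul, commute]
    · simp only [expand, TensorProduct.add_tmul, Finset.sum_add_distrib, symm, zero_add]
  rw [LinearMap.comp_apply, LinearMap.comp_apply, dη]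
  simp only [hd, map_sum, hη, hELeibniz, TensorProduct.tmul_add, Finset.sum_add_distrib, contract]
  rw [Finset.sum_comm (f := fun q i => (f i * D i (D q g + B q * g)) ⊗ₜ[K]
      (ExteriorAlgebra.ι K (Pi.single q 1) * w)),
    Finset.sum_comm (f := fun q i => (f i * B i * (D q g + B q * g)) ⊗ₜ[K]
      (ExteriorAlgebra.ι K (Pi.single q 1) * w)),
    Finset.sum_comm (f := fun q i => ∑ p, (D p (f i) * (D q g + B q * g)) ⊗ₜ[K]
      (ExteriorAlgebra.ι K (Pi.single q 1) * E p i w))]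
  simp only [fun i => Finset.sum_comm (s := Finset.univ) (t := Finset.univ)
    (f := fun q p => (D p (f i) * (D q g + B q * g)) ⊗ₜ[K]
      (ExteriorAlgebra.ι K (Pi.single q 1) * E p i w))]
  abel
end

section
/- There do not exist polynomials f_1,…,f_N ∈ K[x_1,…,x_N] such that Σ_{i=1}^N (∂f_i/∂x_i − 2 x_i f_i) = 1. Equivalently, the constant polynomial 1 does not lie in the image of the top de Rham differential d_{N−1} with gauge fields B_i = −2x_i. -/
/-- The normalized moments of the weight `exp (-x²)`. -/
def gaussianMoment (K : Type*) [Field K] : ℕ → K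
  | 0 => 1
  | 1 => 0
  | n + 2 => (n + 1) / 2 * gaussianMoment K n

theorem two_mul_gaussianMoment_succ {K : Type*} [Field K] [CharZero K] (n : ℕ) :
    2 * gaussianMoment K (n + 1) = n * gaussianMoment K (n - 1) := by
  cases n with
  | zero => simp [gaussianMoment]
  | succ n =>
    simp only [gaussianMoment, Nat.add_sub_cancel]
    push_cast
    field_simp

/-- The formal Gaussian integral: the linear functional sending a monomial to the product of the
moments of its exponents. -/
noncomputable def gaussianFunctional (K σ : Type*) [Field K] [Fintype σ] :
    MvPolynomial σ K →ₗ[K] K :=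
  (MvPolynomial.basisMonomials σ K).constr K fun m => ∏ i, gaussianMoment K (m i)

section

variable {K σ : Type*} [Field K] [Fintype σ]

theorem gaussianFunctional_monomial (m : σ →₀ ℕ) (a : K) :
    gaussianFunctional K σ (MvPolynomial.monomial m a) = a * ∏ i, gaussianMoment K (m i) := by
  have h : MvPolynomial.monomial m a = a • MvPolynomial.basisMonomials σ K m := by
    simp [MvPolynomial.smul_monomial]
  rw [h, map_smul, gaussianFunctional, Module.Basis.constr_basis, smul_eq_mul]

theorem gaussianFunctional_one : gaussianFunctional K σ 1 = 1 := by
  have h := gaussianFunctional_monomial (K := K) (σ := σ) 0 1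
  simpa [gaussianMoment] using h

/-- The formal Gaussian integral satisfies integration by parts. -/
theorem gaussianFunctional_pderiv_sub [CharZero K] (i : σ) (p : MvPolynomial σ K) :
    gaussianFunctional K σ (MvPolynomial.pderiv i p - 2 * MvPolynomial.X i * p) = 0 := by
  classical
  induction p using MvPolynomial.induction_on' with
  | add p q hp hq =>
    rw [map_add, mul_add, add_sub_add_comm, map_add, hp, hq, add_zero]
  | monomial m a =>
    have hX : 2 * MvPolynomial.X i * MvPolynomial.monomial m a =
        MvPolynomial.monomial (m + Finsupp.single i 1) (2 * a) := by
      rw [mul_assoc, mul_comm (MvPolynomial.X i), MvPolynomial.X, MvPolynomial.monomial_mul,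
        two_mul, ← map_add, mul_one, two_mul]
    have hrest (m' : σ →₀ ℕ) (h : ∀ j, j ≠ i → m' j = m j) :
        ∏ j, gaussianMoment K (m' j) =
          gaussianMoment K (m' i) * ∏ j ∈ Finset.univ.erase i, gaussianMoment K (m j) := by
      rw [← Finset.mul_prod_erase _ _ (Finset.mem_univ i)]
      congr 1
      exact Finset.prod_congr rfl fun j hj => by rw [h j (Finset.ne_of_mem_erase hj)]
    rw [MvPolynomial.pderiv_monomial, hX, map_sub, gaussianFunctional_monomial,
      gaussianFunctional_monomial, hrest (m - Finsupp.single i 1), hrest (m + Finsupp.single i 1)]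
    · simp only [Finsupp.tsub_apply, Finsupp.add_apply, Finsupp.single_eq_same]
      linear_combination (-a * ∏ j ∈ Finset.univ.erase i, gaussianMoment K (m j)) *
        two_mul_gaussianMoment_succ (K := K) (m i)
    · intro j hj
      simp [hj.symm]
    · intro j hj
      simp [hj.symm]

end

/-- There do not exist polynomials `f_1,…,f_N ∈ K[x_1,…,x_N]` such that
`Σ_i (∂f_i/∂x_i − 2 x_i f_i) = 1`; equivalently, the constant polynomial `1` is
not in the image of the top de Rham differential with gauge fields `B_i = −2x_i`. -/
theorem one_not_in_image_top_differential (K : Type*) [Field K] [CharZero K]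
    (N : ℕ) (hN : 1 ≤ N) :
    ¬ ∃ f : Fin N → MvPolynomial (Fin N) K,
        ∑ i : Fin N,
          (MvPolynomial.pderiv i (f i) - 2 * MvPolynomial.X i * f i) = 1 := by
  rintro ⟨f, hf⟩
  have h := congrArg (gaussianFunctional K (Fin N)) hf
  rw [map_sum, Finset.sum_eq_zero fun i _ => gaussianFunctional_pderiv_sub i (f i),
    gaussianFunctional_one] at h
  exact zero_ne_one h
end

section
/- For all m, n ∈ ℤ, the operators E_n on N(α) satisfy E_m ∘ E_n − E_n ∘ E_m = (n − m) E_{m+n}. Hence the assignment t^{n+1} d/dt ↦ E_n makes N(α) a module over the Lie algebra W_1 of derivations of K[t, t^{-1}]. -/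
noncomputable section

/-- The basis vector `v_k` of the module `N(α)`. -/
def vv (K : Type*) [Field K] (k : ℤ) : (ℤ ⊕ ℤ) →₀ K := Finsupp.single (Sum.inl k) 1

/-- The basis vector `u_k` of the module `N(α)`. -/
def uu (K : Type*) [Field K] (k : ℤ) : (ℤ ⊕ ℤ) →₀ K := Finsupp.single (Sum.inr k) 1

/-- The operators `E_n` on `N(α)` defined by `E_n v_k = (k+αn)v_{n+k} + u_{n+k}` and
`E_n u_k = (k+αn)u_{n+k} + v_{n+k+1}` satisfy `E_m E_n − E_n E_m = (n−m) E_{m+n}`;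
hence `t^{n+1} d/dt ↦ E_n` makes `N(α)` a module over the Lie algebra `W_1` of
derivations of `K[t,t⁻¹]`. -/
theorem Nalpha_commutator (K : Type*) [Field K] [CharZero K] [IsAlgClosed K] (α : K)
    (E : ℤ → (((ℤ ⊕ ℤ) →₀ K) →ₗ[K] ((ℤ ⊕ ℤ) →₀ K)))
    (hEv : ∀ n k : ℤ,
        E n (vv K k) = ((k : K) + α * n) • vv K (n + k) + uu K (n + k))
    (hEu : ∀ n k : ℤ,
        E n (uu K k) = ((k : K) + α * n) • uu K (n + k) + vv K (n + k + 1)) :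
    ∀ m n : ℤ,
      E m ∘ₗ E n - E n ∘ₗ E m = (((n : K) - (m : K)) • E (m + n)) := by
  intro m n
  have shift : ∀ k : ℤ, n + (m + k) = m + (n + k) := fun k => by ring
  have shift_succ : ∀ a k : ℤ, a + (k + 1) = a + k + 1 := fun a k => by ring
  refine Finsupp.lhom_ext' fun i => LinearMap.ext_ring ?_
  rcases i with k | k
  · change E m (E n (vv K k)) - E n (E m (vv K k)) = ((n : K) - m) • E (m + n) (vv K k)
    simp only [hEv, hEu, map_add, map_smul, shift, add_assoc m n k]
    push_cast
    module
  · change E m (E n (uu K k)) - E n (E m (uu K k)) = ((n : K) - m) • E (m + n) (uu K k)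
    simp only [hEv, hEu, map_add, map_smul, shift_succ, shift, add_assoc m n k]
    push_cast
    module
end
end

section
/- The Casimir operator C = E_0 ∘ E_0 + E_0 − E_{-1} ∘ E_1 acts on N(α) as the scalar γ = α(α − 1), i.e. C(w) = α(α−1) w for every w ∈ N(α). -/
noncomputable section

/-- The Casimir operator `C = E_0² + E_0 − E_{−1}E_1` acts on `N(α)` as the scalar
`γ = α(α−1)`. -/
theorem Nalpha_casimir (K : Type*) [Field K] [CharZero K] [IsAlgClosed K] (α : K)
    (E : ℤ → (((ℤ ⊕ ℤ) →₀ K) →ₗ[K] ((ℤ ⊕ ℤ) →₀ K)))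
    (hEv : ∀ n k : ℤ,
        E n (vv K k) = ((k : K) + α * n) • vv K (n + k) + uu K (n + k))
    (hEu : ∀ n k : ℤ,
        E n (uu K k) = ((k : K) + α * n) • uu K (n + k) + vv K (n + k + 1)) :
    ∀ w : (ℤ ⊕ ℤ) →₀ K,
      E 0 (E 0 w) + E 0 w - E (-1) (E 1 w) = (α * (α - 1)) • w := by
  have hv : ∀ k : ℤ, E 0 (E 0 (vv K k)) + E 0 (vv K k) - E (-1) (E 1 (vv K k)) =
      (α * (α - 1)) • vv K k := by
    intro k
    simp only [hEv, hEu, map_add, map_smul, zero_add, neg_add_cancel_left, add_comm k 1]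
    push_cast
    module
  have hu : ∀ k : ℤ, E 0 (E 0 (uu K k)) + E 0 (uu K k) - E (-1) (E 1 (uu K k)) =
      (α * (α - 1)) • uu K k := by
    intro k
    simp only [hEv, hEu, map_add, map_smul, zero_add, neg_add_cancel_left, add_comm _ (1 : ℤ)]
    push_cast
    module
  have hC : E 0 ∘ₗ E 0 + E 0 - E (-1) ∘ₗ E 1 = (α * (α - 1)) • LinearMap.id := by
    refine Finsupp.lhom_ext' fun i => LinearMap.ext_ring ?_
    rcases i with k | k
    · exact hv k
    · exact hu k
  exact fun w => LinearMap.congr_fun hC w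
end
end

section
/- In N(0), the linear span of the vectors E_0^n v_0 for n ≥ 0 equals N_+ = span{v_k, u_k : k ≥ 0}. -/
noncomputable section

/-- The span of the iterates `fⁿ x` is stable under `f`. -/
theorem map_mem_span_range_pow_apply {R M : Type*} [Semiring R] [AddCommMonoid M] [Module R M]
    (f : M →ₗ[R] M) (x : M) {y : M}
    (hy : y ∈ Submodule.span R (Set.range fun n : ℕ => (f ^ n) x)) :
    f y ∈ Submodule.span R (Set.range fun n : ℕ => (f ^ n) x) := by
  suffices h : Submodule.span R (Set.range fun n : ℕ => (f ^ n) x) ≤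
      (Submodule.span R (Set.range fun n : ℕ => (f ^ n) x)).comap f from h hy
  rw [Submodule.span_le]
  rintro _ ⟨n, rfl⟩
  exact Submodule.subset_span ⟨n + 1, by simp only [pow_succ', Module.End.mul_apply]⟩

/-- In `N(0)`, the span of the vectors `E_0ⁿ v_0`, `n ≥ 0`, equals
`N_+ = span{v_k, u_k : k ≥ 0}`. -/
theorem Nzero_span_E0_powers (K : Type*) [Field K] [CharZero K] [IsAlgClosed K]
    (E : ℤ → (((ℤ ⊕ ℤ) →₀ K) →ₗ[K] ((ℤ ⊕ ℤ) →₀ K)))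
    (hEv : ∀ n k : ℤ, E n (vv K k) = (k : K) • vv K (n + k) + uu K (n + k))
    (hEu : ∀ n k : ℤ, E n (uu K k) = (k : K) • uu K (n + k) + vv K (n + k + 1)) :
    Submodule.span K (Set.range fun n : ℕ => ((E 0) ^ n) (vv K 0))
      = Submodule.span K
          ((Set.range fun k : ℕ => vv K (k : ℤ))
            ∪ (Set.range fun k : ℕ => uu K (k : ℤ))) := by
  have hv (k : ℕ) : E 0 (vv K k) = (k : K) • vv K k + uu K k := by
    simpa using hEv 0 k
  have hu (k : ℕ) : E 0 (uu K k) = (k : K) • uu K k + vv K (k + 1 : ℕ) := by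
    simpa using hEu 0 k
  apply le_antisymm
  · set N := Submodule.span K
      ((Set.range fun k : ℕ => vv K (k : ℤ)) ∪ (Set.range fun k : ℕ => uu K (k : ℤ))) with hN
    have hvN (k : ℕ) : vv K k ∈ N := Submodule.subset_span (Or.inl ⟨k, rfl⟩)
    have huN (k : ℕ) : uu K k ∈ N := Submodule.subset_span (Or.inr ⟨k, rfl⟩)
    have hE : N ≤ N.comap (E 0) := by
      conv_lhs => rw [hN]
      rw [Submodule.span_le]
      rintro _ (⟨k, rfl⟩ | ⟨k, rfl⟩)
      · simpa only [SetLike.mem_coe, Submodule.mem_comap, hv] using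
          N.add_mem (N.smul_mem _ (hvN k)) (huN k)
      · simpa only [SetLike.mem_coe, Submodule.mem_comap, hu] using
          N.add_mem (N.smul_mem _ (huN k)) (hvN (k + 1))
    rw [Submodule.span_le]
    rintro _ ⟨n, rfl⟩
    induction n with
    | zero => simpa using hvN 0
    | succ n ih =>
      simp only [pow_succ', Module.End.mul_apply]
      exact hE ih
  · set S := Submodule.span K (Set.range fun n : ℕ => ((E 0) ^ n) (vv K 0))
    have hE {y} (hy : y ∈ S) : E 0 y ∈ S := map_mem_span_range_pow_apply _ _ hy
    have huS {k : ℕ} (h : vv K k ∈ S) : uu K k ∈ S :=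
      (S.add_mem_iff_right (S.smul_mem (k : K) h)).1 (hv k ▸ hE h)
    have hvS (k : ℕ) : vv K k ∈ S := by
      induction k with
      | zero => exact Submodule.subset_span ⟨0, by simp⟩
      | succ k ih =>
        exact (S.add_mem_iff_right (S.smul_mem (k : K) (huS ih))).1 (hu k ▸ hE (huS ih))
    rw [Submodule.span_le]
    rintro _ (⟨k, rfl⟩ | ⟨k, rfl⟩)
    · exact hvS k
    · exact huS (hvS k)
end
end

section
/- The set {v_0} ∪ {E_0^n v_0 : n ≥ 1} ∪ {E_{-1}^n v_0 : n ≥ 1} of vectors in N(0) is linearly independent, its span is invariant under the operators E_{-1}, E_0 and E_1, and its span equals M, the smallest subspace of N(0) containing v_0 that is invariant under E_{-1}, E_0 and E_1. In particular this set is a basis of M. -/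
noncomputable section

/-- The smallest subspace of `N(0)` containing `v_0` and invariant under
`E_{-1}`, `E_0` and `E_1`. -/
def Msub (K : Type*) [Field K]
    (E : ℤ → (((ℤ ⊕ ℤ) →₀ K) →ₗ[K] ((ℤ ⊕ ℤ) →₀ K))) :
    Submodule K ((ℤ ⊕ ℤ) →₀ K) :=
  sInf {W : Submodule K ((ℤ ⊕ ℤ) →₀ K) |
    vv K 0 ∈ W ∧ ∀ i ∈ ({-1, 0, 1} : Set ℤ), ∀ x ∈ W, E i x ∈ W}

/-- The basis vectors of `N(0)` in a single sequence: `t_{2k} = v_k` and `t_{2k+1} = u_k`. -/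
def tIndex (n : ℤ) : ℤ ⊕ ℤ := if n % 2 = 0 then Sum.inl (n / 2) else Sum.inr (n / 2)

theorem tIndex_injective : Function.Injective tIndex := by
  intro a b h
  unfold tIndex at h
  split_ifs at h <;> simp at h <;> omega

theorem tIndex_two_mul (k : ℤ) : tIndex (2 * k) = Sum.inl k := by
  simp [tIndex]

theorem tIndex_two_mul_add_one (k : ℤ) : tIndex (2 * k + 1) = Sum.inr k := by
  have h1 : (2 * k + 1) % 2 = 1 := by omega
  have h2 : (2 * k + 1) / 2 = k := by omega
  simp [tIndex, h1, h2]

/-- The basis vector `t_n` of `N(0)`. -/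
def tt (K : Type*) [Field K] (n : ℤ) : (ℤ ⊕ ℤ) →₀ K := Finsupp.single (tIndex n) 1

section

variable {K : Type*} [Field K]

theorem tt_two_mul (k : ℤ) : tt K (2 * k) = vv K k := by
  rw [tt, tIndex_two_mul, vv]

theorem tt_two_mul_add_one (k : ℤ) : tt K (2 * k + 1) = uu K k := by
  rw [tt, tIndex_two_mul_add_one, uu]

theorem apply_tIndex_of_mem_span {s : Set ℤ} {n : ℤ} (hn : n ∉ s) {w : (ℤ ⊕ ℤ) →₀ K}
    (hw : w ∈ Submodule.span K (tt K '' s)) : w (tIndex n) = 0 := by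
  have hle : Submodule.span K (tt K '' s) ≤
      LinearMap.ker (Finsupp.lapply (tIndex n) : ((ℤ ⊕ ℤ) →₀ K) →ₗ[K] K) := by
    rw [Submodule.span_le]
    rintro _ ⟨j, hj, rfl⟩
    have hjn : tIndex j ≠ tIndex n := fun h => hn (tIndex_injective h ▸ hj)
    simp [tt, hjn]
  exact hle hw

/-- A family of finitely supported functions which is triangular with nonzero diagonal, with
respect to a rank function on its index set, is linearly independent. -/
theorem linearIndependent_of_triangular_rank {ι α : Type*} (g : ι → α →₀ K) (r : ι → ℕ)
    (pos : ι → α) (hdiag : ∀ i, g i (pos i) ≠ 0)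
    (hoff : ∀ i j, j ≠ i → r j ≤ r i → g j (pos i) = 0) : LinearIndependent K g := by
  rw [linearIndependent_iff]
  intro c hc
  by_contra hne
  obtain ⟨i, hi, hmax⟩ := c.support.exists_max_image r (Finsupp.support_nonempty_iff.2 hne)
  have h := DFunLike.congr_fun hc (pos i)
  rw [Finsupp.linearCombination_apply, Finsupp.sum, Finsupp.finsetSum_apply,
    Finset.sum_eq_single i] at h
  · simp [hdiag i] at h
    exact (Finsupp.mem_support_iff.1 hi) h
  · intro j hj hji
    simp [hoff i j hji (hmax j hj)]
  · exact fun h' => absurd hi h'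

theorem linearMap_ext_vv_uu {f h : ((ℤ ⊕ ℤ) →₀ K) →ₗ[K] ((ℤ ⊕ ℤ) →₀ K)}
    (hv : ∀ k, f (vv K k) = h (vv K k)) (hu : ∀ k, f (uu K k) = h (uu K k)) : f = h := by
  refine Finsupp.lhom_ext' fun a => LinearMap.ext_ring ?_
  rcases a with k | k
  · exact hv k
  · exact hu k

variable {E : ℤ → (((ℤ ⊕ ℤ) →₀ K) →ₗ[K] ((ℤ ⊕ ℤ) →₀ K))}

theorem E_tt
    (hEv : ∀ n k : ℤ, E n (vv K k) = (k : K) • vv K (n + k) + uu K (n + k))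
    (hEu : ∀ n k : ℤ, E n (uu K k) = (k : K) • uu K (n + k) + vv K (n + k + 1))
    (n k : ℤ) :
    E n (tt K k) = ((k / 2 : ℤ) : K) • tt K (2 * n + k) + tt K (2 * n + k + 1) := by
  obtain ⟨j, rfl | rfl⟩ : ∃ j, k = 2 * j ∨ k = 2 * j + 1 := ⟨k / 2, by omega⟩
  · rw [← mul_add, tt_two_mul, tt_two_mul, tt_two_mul_add_one, hEv,
      Int.mul_ediv_cancel_left _ two_ne_zero]
  · rw [show 2 * n + (2 * j + 1) + 1 = 2 * (n + j + 1) by ring,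
      show 2 * n + (2 * j + 1) = 2 * (n + j) + 1 by ring, tt_two_mul, tt_two_mul_add_one,
      tt_two_mul_add_one, hEu, show (2 * j + 1) / 2 = j by omega]

theorem E_zero_E
    (hEv : ∀ n k : ℤ, E n (vv K k) = (k : K) • vv K (n + k) + uu K (n + k))
    (hEu : ∀ n k : ℤ, E n (uu K k) = (k : K) • uu K (n + k) + vv K (n + k + 1))
    (n : ℤ) (x : (ℤ ⊕ ℤ) →₀ K) :
    E 0 (E n x) = E n (E 0 x) + (n : K) • E n x := by
  have h : E 0 ∘ₗ E n = E n ∘ₗ E 0 + (n : K) • E n := by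
    refine linearMap_ext_vv_uu (fun k => ?_) (fun k => ?_)
    · simp only [LinearMap.comp_apply, LinearMap.add_apply, LinearMap.smul_apply, hEv, hEu,
        map_add, map_smul, zero_add, Int.cast_add]
      module
    · simp only [LinearMap.comp_apply, LinearMap.add_apply, LinearMap.smul_apply, hEv, hEu,
        map_add, map_smul, zero_add, Int.cast_add, Int.cast_one, ← add_assoc]
      module
  exact LinearMap.congr_fun h x

theorem E_one_E_neg_one
    (hEv : ∀ n k : ℤ, E n (vv K k) = (k : K) • vv K (n + k) + uu K (n + k))
    (hEu : ∀ n k : ℤ, E n (uu K k) = (k : K) • uu K (n + k) + vv K (n + k + 1))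
    (x : (ℤ ⊕ ℤ) →₀ K) :
    E 1 (E (-1) x) = E 0 (E 0 x) - E 0 x := by
  have h : E 1 ∘ₗ E (-1) = E 0 ∘ₗ E 0 - E 0 := by
    refine linearMap_ext_vv_uu (fun k => ?_) (fun k => ?_)
    · simp only [LinearMap.comp_apply, LinearMap.sub_apply, hEv, hEu,
        map_add, map_smul, zero_add, Int.cast_add, add_neg_cancel_left, Int.cast_neg, Int.cast_one]
      module
    · simp only [LinearMap.comp_apply, LinearMap.sub_apply, hEv, hEu,
        map_add, map_smul, zero_add, Int.cast_add, Int.cast_neg, Int.cast_one,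
        ← add_assoc, add_neg_cancel]
      module
  exact LinearMap.congr_fun h x

theorem E_mem_span_tt
    (hEv : ∀ n k : ℤ, E n (vv K k) = (k : K) • vv K (n + k) + uu K (n + k))
    (hEu : ∀ n k : ℤ, E n (uu K k) = (k : K) • uu K (n + k) + vv K (n + k + 1))
    (n : ℤ) {s s₁ : Set ℤ}
    (hs : ∀ k ∈ s, 2 * n + k ∈ s₁ ∧ 2 * n + k + 1 ∈ s₁) {w : (ℤ ⊕ ℤ) →₀ K}
    (hw : w ∈ Submodule.span K (tt K '' s)) : E n w ∈ Submodule.span K (tt K '' s₁) := by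
  have hle : Submodule.span K (tt K '' s) ≤ (Submodule.span K (tt K '' s₁)).comap (E n) := by
    rw [Submodule.span_le]
    rintro _ ⟨k, hk, rfl⟩
    rw [SetLike.mem_coe, Submodule.mem_comap, E_tt hEv hEu]
    exact add_mem (Submodule.smul_mem _ _ (Submodule.subset_span ⟨_, (hs k hk).1, rfl⟩))
      (Submodule.subset_span ⟨_, (hs k hk).2, rfl⟩)
  exact hle hw

theorem E_zero_pow_vv_zero
    (hEv : ∀ n k : ℤ, E n (vv K k) = (k : K) • vv K (n + k) + uu K (n + k))
    (hEu : ∀ n k : ℤ, E n (uu K k) = (k : K) • uu K (n + k) + vv K (n + k + 1))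
    (n : ℕ) :
    ∃ w ∈ Submodule.span K (tt K '' Set.Ico 0 (n : ℤ)),
      ((E 0) ^ n) (vv K 0) = tt K n + w := by
  induction n with
  | zero => exact ⟨0, zero_mem _, by simp [← tt_two_mul]⟩
  | succ n ih =>
    obtain ⟨w, hw, h⟩ := ih
    refine ⟨((n / 2 : ℤ) : K) • tt K n + E 0 w, add_mem (Submodule.smul_mem _ _
      (Submodule.subset_span ⟨n, by simp, rfl⟩)) (E_mem_span_tt hEv hEu 0 ?_ hw), ?_⟩
    · intro k hk
      simp only [Set.mem_Ico] at hk ⊢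
      omega
    · rw [pow_succ', Module.End.mul_apply, h, map_add, E_tt hEv hEu]
      simp only [mul_zero, zero_add, Nat.cast_add, Nat.cast_one]
      abel

theorem E_neg_one_pow_vv_zero [CharZero K]
    (hEv : ∀ n k : ℤ, E n (vv K k) = (k : K) • vv K (n + k) + uu K (n + k))
    (hEu : ∀ n k : ℤ, E n (uu K k) = (k : K) • uu K (n + k) + vv K (n + k + 1))
    (n : ℕ) :
    ∃ c : K, c ≠ 0 ∧ ∃ w ∈ Submodule.span K (tt K '' Set.Ioo (-(2 * n + 1) : ℤ) 0),
      ((E (-1)) ^ (n + 1)) (vv K 0) = c • tt K (-(2 * n + 1)) + w := by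
  induction n with
  | zero =>
    refine ⟨1, one_ne_zero, 0, zero_mem _, ?_⟩
    rw [← tt_two_mul, zero_add, pow_one, E_tt hEv hEu]
    simp
  | succ n ih =>
    obtain ⟨c, hc, w, hw, h⟩ := ih
    have hdiv : (-(2 * n + 1) : ℤ) / 2 = -(n + 1) := by omega
    refine ⟨c * (-(n + 1)), mul_ne_zero hc (neg_ne_zero.2 (Nat.cast_add_one_ne_zero n)),
      c • tt K (-(2 * n + 2)) + E (-1) w, add_mem (Submodule.smul_mem _ _
      (Submodule.subset_span ⟨_, ?_, rfl⟩)) (E_mem_span_tt hEv hEu (-1) ?_ hw), ?_⟩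
    · simp only [Set.mem_Ioo]
      omega
    · intro k hk
      simp only [Set.mem_Ioo] at hk ⊢
      omega
    · rw [pow_succ', Module.End.mul_apply, h, map_add, map_smul, E_tt hEv hEu, hdiv]
      rw [show (2 * -1 + -(2 * n + 1) + 1 : ℤ) = -(2 * n + 2) by ring,
        show (2 * -1 + -(2 * n + 1) : ℤ) = -(2 * ((n + 1 : ℕ) : ℤ) + 1) by push_cast; ring]
      push_cast
      module

theorem linearIndependent_pow_vv_zero [CharZero K]
    (hEv : ∀ n k : ℤ, E n (vv K k) = (k : K) • vv K (n + k) + uu K (n + k))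
    (hEu : ∀ n k : ℤ, E n (uu K k) = (k : K) • uu K (n + k) + vv K (n + k + 1)) :
    LinearIndependent K (Sum.elim (fun n : ℕ => ((E 0) ^ n) (vv K 0))
      (fun n : ℕ => ((E (-1)) ^ (n + 1)) (vv K 0))) := by
  refine linearIndependent_of_triangular_rank _ (Sum.elim id id)
    (Sum.elim (fun n => tIndex n) (fun n => tIndex (-(2 * n + 1)))) ?_ ?_
  · rintro (n | n)
    · obtain ⟨w, hw, h⟩ := E_zero_pow_vv_zero hEv hEu n
      simp [h, tt, apply_tIndex_of_mem_span (n := n) (by simp) hw]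
    · obtain ⟨c, hc, w, hw, h⟩ := E_neg_one_pow_vv_zero hEv hEu n
      simp only [Sum.elim_inr, h, Finsupp.add_apply, Finsupp.smul_apply,
        apply_tIndex_of_mem_span (n := -(2 * n + 1)) (by simp) hw]
      simpa [tt] using hc
  · rintro i (m | m) hne hle
    · obtain ⟨w, hw, h⟩ := E_zero_pow_vv_zero hEv hEu m
      have hmem : ((E 0) ^ m) (vv K 0) ∈ Submodule.span K (tt K '' Set.Icc 0 (m : ℤ)) := by
        rw [h]
        exact add_mem (Submodule.subset_span ⟨m, by simp, rfl⟩)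
          (Submodule.span_mono (Set.image_mono Set.Ico_subset_Icc_self) hw)
      rcases i with n | n <;> refine apply_tIndex_of_mem_span ?_ hmem
      · have : m ≠ n := fun h => hne (h ▸ rfl)
        simp at hle ⊢
        omega
      · simp only [Set.mem_Icc]
        omega
    · obtain ⟨c, -, w, hw, h⟩ := E_neg_one_pow_vv_zero hEv hEu m
      have hmem : ((E (-1)) ^ (m + 1)) (vv K 0) ∈
          Submodule.span K (tt K '' Set.Ico (-(2 * m + 1) : ℤ) 0) := by
        rw [h]
        refine add_mem (Submodule.smul_mem _ _ (Submodule.subset_span ⟨_, ?_, rfl⟩))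
          (Submodule.span_mono (Set.image_mono Set.Ioo_subset_Ico_self) hw)
        simp only [Set.mem_Ico]
        omega
      rcases i with n | n <;> refine apply_tIndex_of_mem_span ?_ hmem
      · simp
      · have : m ≠ n := fun h => hne (h ▸ rfl)
        simp at hle ⊢
        omega

theorem E_zero_E_neg_one_pow
    (hEv : ∀ n k : ℤ, E n (vv K k) = (k : K) • vv K (n + k) + uu K (n + k))
    (hEu : ∀ n k : ℤ, E n (uu K k) = (k : K) • uu K (n + k) + vv K (n + k + 1))
    (m : ℕ) :
    E 0 (((E (-1)) ^ (m + 1)) (vv K 0)) =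
      ((E (-1)) ^ m) (vv K 0) - ((m : K) + 1) • ((E (-1)) ^ (m + 1)) (vv K 0) := by
  induction m with
  | zero =>
    have h : E (-1) (E 0 (vv K 0)) = vv K 0 := by simp [hEv, hEu]
    rw [zero_add, pow_one, E_zero_E hEv hEu, h]
    simp [sub_eq_add_neg]
  | succ m ih =>
    rw [pow_succ' (E (-1)) (m + 1), Module.End.mul_apply, E_zero_E hEv hEu, ih, map_sub, map_smul,
      ← Module.End.mul_apply (E (-1)) ((E (-1)) ^ m), ← pow_succ']
    push_cast
    module

theorem E_mem_span_pow_vv_zero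
    (hEv : ∀ n k : ℤ, E n (vv K k) = (k : K) • vv K (n + k) + uu K (n + k))
    (hEu : ∀ n k : ℤ, E n (uu K k) = (k : K) • uu K (n + k) + vv K (n + k + 1))
    {S : Submodule K ((ℤ ⊕ ℤ) →₀ K)}
    (hS : S = Submodule.span K (Set.range (Sum.elim (fun n : ℕ => ((E 0) ^ n) (vv K 0))
      (fun n : ℕ => ((E (-1)) ^ (n + 1)) (vv K 0))))) :
    ∀ i ∈ ({-1, 0, 1} : Set ℤ), ∀ x ∈ S, E i x ∈ S := by
  have hpos : ∀ n : ℕ, ((E 0) ^ n) (vv K 0) ∈ S := fun n =>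
    hS ▸ Submodule.subset_span ⟨Sum.inl n, rfl⟩
  have hneg : ∀ n : ℕ, ((E (-1)) ^ n) (vv K 0) ∈ S := by
    rintro (_ | n)
    · exact hpos 0
    · exact hS ▸ Submodule.subset_span ⟨Sum.inr n, rfl⟩
  have hext : ∀ i, (∀ n : ℕ, E i (((E 0) ^ n) (vv K 0)) ∈ S) →
      (∀ n : ℕ, E i (((E (-1)) ^ (n + 1)) (vv K 0)) ∈ S) → ∀ x ∈ S, E i x ∈ S := by
    intro i h0 h1
    change S ≤ S.comap (E i)
    conv_lhs => rw [hS]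
    rw [Submodule.span_le]
    rintro _ ⟨n | n, rfl⟩
    · exact h0 n
    · exact h1 n
  have hE0 : ∀ x ∈ S, E 0 x ∈ S := by
    refine hext 0 (fun n => ?_) (fun n => ?_)
    · rw [← Module.End.mul_apply, ← pow_succ']
      exact hpos _
    · rw [E_zero_E_neg_one_pow hEv hEu]
      exact sub_mem (hneg n) (Submodule.smul_mem _ _ (hneg _))
  have hstep : ∀ i, E i (vv K 0) ∈ S → ∀ n : ℕ, E i (((E 0) ^ n) (vv K 0)) ∈ S := by
    intro i hi n
    induction n with
    | zero => exact hi
    | succ n ih =>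
      rw [pow_succ', Module.End.mul_apply,
        eq_sub_of_add_eq (E_zero_E hEv hEu i (((E 0) ^ n) (vv K 0))).symm]
      exact sub_mem (hE0 _ ih) (Submodule.smul_mem _ _ ih)
  rintro i (rfl | rfl | rfl)
  · refine hext _ (hstep _ (hneg 1)) fun n => ?_
    rw [← Module.End.mul_apply, ← pow_succ']
    exact hneg _
  · exact hE0
  · refine hext _ (hstep _ ?_) fun n => ?_
    · have h : E 1 (vv K 0) = E 0 (E 0 (E 0 (vv K 0))) - E 0 (E 0 (vv K 0)) := by
        simp [hEv, hEu]
      have h2 : E 0 (E 0 (vv K 0)) ∈ S := hE0 _ (hE0 _ (hpos 0))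
      rw [h]
      exact sub_mem (hE0 _ h2) h2
    · rw [pow_succ', Module.End.mul_apply, E_one_E_neg_one hEv hEu]
      exact sub_mem (hE0 _ (hE0 _ (hneg n))) (hE0 _ (hneg n))

end

/-- The family `{v_0} ∪ {E_0ⁿ v_0 : n ≥ 1} ∪ {E_{-1}ⁿ v_0 : n ≥ 1}` in `N(0)` is
linearly independent, its span is invariant under `E_{-1}`, `E_0`, `E_1`, and its
span is `M`, the smallest subspace containing `v_0` invariant under these operators;
in particular, this set is a basis of `M`. -/
theorem Nzero_basis_of_M (K : Type*) [Field K] [CharZero K] [IsAlgClosed K]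
    (E : ℤ → (((ℤ ⊕ ℤ) →₀ K) →ₗ[K] ((ℤ ⊕ ℤ) →₀ K)))
    (hEv : ∀ n k : ℤ, E n (vv K k) = (k : K) • vv K (n + k) + uu K (n + k))
    (hEu : ∀ n k : ℤ, E n (uu K k) = (k : K) • uu K (n + k) + vv K (n + k + 1))
    (g : ℕ ⊕ ℕ → ((ℤ ⊕ ℤ) →₀ K))
    (hg : g = Sum.elim (fun n : ℕ => ((E 0) ^ n) (vv K 0))
                        (fun n : ℕ => ((E (-1)) ^ (n + 1)) (vv K 0))) :
    LinearIndependent K g ∧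
    (∀ i ∈ ({-1, 0, 1} : Set ℤ), ∀ x ∈ Submodule.span K (Set.range g),
        E i x ∈ Submodule.span K (Set.range g)) ∧
    Submodule.span K (Set.range g) = Msub K E := by
  subst hg
  have hinv := E_mem_span_pow_vv_zero hEv hEu rfl
  refine ⟨linearIndependent_pow_vv_zero hEv hEu, hinv, le_antisymm ?_ ?_⟩
  · refine le_sInf fun W hW => ?_
    have hpow : ∀ i ∈ ({-1, 0, 1} : Set ℤ), ∀ n : ℕ, ((E i) ^ n) (vv K 0) ∈ W := by
      intro i hi n
      induction n with
      | zero => exact hW.1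
      | succ n ih =>
        rw [pow_succ', Module.End.mul_apply]
        exact hW.2 i hi _ ih
    rw [Submodule.span_le]
    rintro _ ⟨n | n, rfl⟩
    · exact hpow 0 (by simp) n
    · exact hpow (-1) (by simp) (n + 1)
  · exact sInf_le ⟨Submodule.subset_span ⟨Sum.inl 0, rfl⟩, hinv⟩
end
end

section
/- Every subspace of N(0) that is invariant under the operators E_{-1}, E_0 and E_1 equals 0, M, or N(0). In particular, M is the unique nonzero proper sl_2-submodule of N(0). -/
noncomputable section

section Ladder

variable {K N : Type*} [Field K] [AddCommGroup N] [Module K N] {w : ℤ → N}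
  {E : ℤ → N →ₗ[K] N}

/-- Linear maps send the span of a family into any submodule containing the images of the family. -/
lemma map_mem_of_mem_span_image {s : Set ℤ} {T : N →ₗ[K] N} {P : Submodule K N}
    (h : ∀ j ∈ s, T (w j) ∈ P) {x : N} (hx : x ∈ Submodule.span K (w '' s)) : T x ∈ P := by
  have : Submodule.span K (w '' s) ≤ P.comap T := by
    rw [Submodule.span_le]
    rintro _ ⟨j, hj, rfl⟩
    exact h j hj
  exact this hx

lemma mem_span_image {s : Set ℤ} {j : ℤ} (h : j ∈ s) : w j ∈ Submodule.span K (w '' s) :=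
  Submodule.subset_span ⟨j, h, rfl⟩

lemma exists_smul_add_of_mem_span_image {s t : Set ℤ} {j : ℤ} (h : s ⊆ insert j t) {x : N}
    (hx : x ∈ Submodule.span K (w '' s)) :
    ∃ c : K, ∃ y ∈ Submodule.span K (w '' t), x = c • w j + y := by
  have := Submodule.span_mono (Set.image_mono h) hx
  rw [Set.image_insert_eq, Submodule.mem_span_insert] at this
  exact this

/-- A nonzero vector has a leading term. -/
lemma exists_leading_term (htop : Submodule.span K (Set.range w) = ⊤) {x : N} (hx : x ≠ 0) :
    ∃ a b : ℤ, a ≤ b ∧ ∃ c : K, c ≠ 0 ∧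
      ∃ y ∈ Submodule.span K (w '' Set.Ico a b), x = c • w b + y := by
  have bounded : ∃ a : ℤ, ∃ n : ℕ, x ∈ Submodule.span K (w '' Set.Ico a (a + n)) := by
    have hxt : x ∈ Submodule.span K (Set.range w) := by rw [htop]; trivial
    clear hx
    induction hxt using Submodule.span_induction with
    | mem x h =>
      obtain ⟨j, rfl⟩ := h
      exact ⟨j, 1, mem_span_image (by simp)⟩
    | zero => exact ⟨0, 0, zero_mem _⟩
    | add x y _ _ hx hy =>
      obtain ⟨a, n, hx⟩ := hx
      obtain ⟨b, m, hy⟩ := hy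
      refine ⟨min a b, (max (a + n) (b + m) - min a b).toNat, add_mem
        (Submodule.span_mono (Set.image_mono (Set.Ico_subset_Ico ?_ ?_)) hx)
        (Submodule.span_mono (Set.image_mono (Set.Ico_subset_Ico ?_ ?_)) hy)⟩ <;> omega
    | smul c x _ hx =>
      obtain ⟨a, n, hx⟩ := hx
      exact ⟨a, n, Submodule.smul_mem _ _ hx⟩
  obtain ⟨a, n, h⟩ := bounded
  induction n with
  | zero => simp at h; exact absurd h hx
  | succ n ih =>
    have hs : Set.Ico a (a + (n + 1 : ℕ)) ⊆ insert (a + n) (Set.Ico a (a + n)) := by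
      intro j hj
      simp only [Set.mem_insert_iff, Set.mem_Ico] at hj ⊢
      omega
    obtain ⟨c, y, hy, rfl⟩ := exists_smul_add_of_mem_span_image hs h
    by_cases hc : c = 0
    · exact ih (by simpa [hc] using hy)
    · exact ⟨a, a + n, by omega, c, hc, y, hy, rfl⟩

/-- A nonzero invariant subspace contains a vector with leading coefficient `1`, supported in
nonnegative degrees. -/
lemma exists_leading_term_nonneg
    (hE : ∀ n j : ℤ, E n (w j) = w (j + 1 + 2 * n) + ((j / 2 : ℤ) : K) • w (j + 2 * n))
    (htop : Submodule.span K (Set.range w) = ⊤) {V : Submodule K N}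
    (h₁ : ∀ x ∈ V, E 1 x ∈ V) (hV : V ≠ ⊥) :
    ∃ b : ℕ, ∃ y ∈ Submodule.span K (w '' Set.Ico 0 (b : ℤ)), w b + y ∈ V := by
  obtain ⟨x, hxV, hx⟩ := V.exists_mem_ne_zero_of_ne_bot hV
  obtain ⟨a, b, hab, c, hc, y, hy, rfl⟩ := exists_leading_term htop hx
  have shifted : ∀ k : ℕ, ∃ y ∈ Submodule.span K (w '' Set.Ico (a + 2 * k) (b + 3 * k)),
      w (b + 3 * k) + y ∈ V := by
    intro k
    induction k with
    | zero =>
      refine ⟨c⁻¹ • y, by simpa using Submodule.smul_mem _ _ hy, ?_⟩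
      have := V.smul_mem c⁻¹ hxV
      rw [smul_add, smul_smul, inv_mul_cancel₀ hc, one_smul] at this
      simpa using this
    | succ k ih =>
      obtain ⟨y, hy, hyV⟩ := ih
      refine ⟨(((b + 3 * k) / 2 : ℤ) : K) • w (b + 3 * k + 2 * 1) + E 1 y, add_mem
        (Submodule.smul_mem _ _ (mem_span_image ?_))
        (map_mem_of_mem_span_image (fun j hj => ?_) hy), ?_⟩
      · simp only [Set.mem_Ico]; push_cast; omega
      · rw [hE]
        simp only [Set.mem_Ico] at hj
        refine add_mem (mem_span_image ?_) (Submodule.smul_mem _ _ (mem_span_image ?_)) <;>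
        · simp only [Set.mem_Ico]; push_cast; omega
      · have := h₁ _ hyV
        rw [map_add, hE, add_assoc] at this
        rwa [show (b + 3 * (k + 1 : ℕ) : ℤ) = b + 3 * k + 1 + 2 * 1 by push_cast; ring]
  obtain ⟨y, hy, hyV⟩ := shifted a.natAbs
  have hb : ((b + 3 * a.natAbs).toNat : ℤ) = b + 3 * a.natAbs := by omega
  refine ⟨(b + 3 * a.natAbs).toNat, y, ?_, by rwa [hb]⟩
  rw [hb]
  exact Submodule.span_mono (Set.image_mono (Set.Ico_subset_Ico_left (by omega))) hy

/-- The operator `E₋₁ E₀ - 1` lowers degrees. -/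
lemma lowering_apply
    (hE : ∀ n j : ℤ, E n (w j) = w (j + 1 + 2 * n) + ((j / 2 : ℤ) : K) • w (j + 2 * n)) (j : ℤ) :
    (E (-1) ∘ₗ E 0 - LinearMap.id : N →ₗ[K] N) (w j) =
      (j : K) • w (j - 1) + (((j / 2) * (j / 2) : ℤ) : K) • w (j - 2) := by
  have hj : (j : K) = (((j + 1) / 2 : ℤ) : K) + ((j / 2 : ℤ) : K) := by
    rw [← Int.cast_add]; congr 1; omega
  simp only [LinearMap.sub_apply, LinearMap.comp_apply, LinearMap.id_apply, hE, map_add, map_smul]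
  rw [hj]
  simp only [mul_zero, add_zero, show j + 1 + 1 + 2 * (-1 : ℤ) = j by ring,
    show j + 1 + 2 * (-1 : ℤ) = j - 1 by ring, show j + 2 * (-1 : ℤ) = j - 2 by ring]
  push_cast
  module

lemma degree_zero_mem_of_ne_bot [CharZero K]
    (hE : ∀ n j : ℤ, E n (w j) = w (j + 1 + 2 * n) + ((j / 2 : ℤ) : K) • w (j + 2 * n))
    (htop : Submodule.span K (Set.range w) = ⊤) {V : Submodule K N}
    (hinv : ∀ i ∈ ({-1, 0, 1} : Set ℤ), ∀ x ∈ V, E i x ∈ V) (hV : V ≠ ⊥) : w 0 ∈ V := by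
  obtain ⟨b, y, hy, hyV⟩ := exists_leading_term_nonneg hE htop (hinv 1 (by simp)) hV
  induction b generalizing y with
  | zero =>
    have : y = 0 := by simpa using hy
    simpa [this] using hyV
  | succ b ih =>
    have hlow : (E (-1) ∘ₗ E 0 - LinearMap.id : N →ₗ[K] N) (w (b + 1 : ℕ) + y) ∈ V :=
      sub_mem (hinv _ (by simp) _ (hinv _ (by simp) _ hyV)) hyV
    rw [map_add, lowering_apply hE, add_assoc] at hlow
    have hb : ((b + 1 : ℕ) : K) ≠ 0 := Nat.cast_ne_zero.2 b.succ_ne_zero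
    have hterm : ∀ j : ℤ, 0 ≤ j → j ≤ b + 1 →
        (((j / 2) * (j / 2) : ℤ) : K) • w (j - 2) ∈ Submodule.span K (w '' Set.Ico 0 (b : ℤ)) := by
      intro j hj hjb
      by_cases h : j < 2
      · have : j / 2 = 0 := by omega
        simp [this]
      · exact Submodule.smul_mem _ _ (mem_span_image ⟨by omega, by omega⟩)
    refine ih (((b + 1 : ℕ) : K)⁻¹ • _)
      (Submodule.smul_mem _ _ (add_mem (hterm (b + 1 : ℕ) (by omega) (by omega))
        (map_mem_of_mem_span_image (T := E (-1) ∘ₗ E 0 - LinearMap.id) (fun j hj => ?_) hy))) ?_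
    · simp only [Set.mem_Ico] at hj
      rw [lowering_apply hE]
      refine add_mem ?_ (hterm j hj.1 (by omega))
      by_cases h : j = 0
      · simp [h]
      · exact Submodule.smul_mem _ _ (mem_span_image ⟨by omega, by omega⟩)
    · have := V.smul_mem ((b + 1 : ℕ) : K)⁻¹ hlow
      rw [smul_add, smul_smul, Int.cast_natCast, inv_mul_cancel₀ hb, one_smul] at this
      simpa using this

/-- An invariant subspace containing the vector of degree `0` contains all vectors supported in
degrees at least `-1`. -/
lemma span_Ici_le
    (hE : ∀ n j : ℤ, E n (w j) = w (j + 1 + 2 * n) + ((j / 2 : ℤ) : K) • w (j + 2 * n))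
    {V : Submodule K N} (hinv : ∀ i ∈ ({-1, 0, 1} : Set ℤ), ∀ x ∈ V, E i x ∈ V) (h0 : w 0 ∈ V) :
    Submodule.span K (w '' Set.Ici (-1)) ≤ V := by
  rw [Submodule.span_le]
  rintro _ ⟨j, hj, rfl⟩
  simp only [Set.mem_Ici] at hj
  induction j, hj using Int.leInduction with
  | base => simpa [hE] using hinv (-1) (by simp) _ h0
  | succ j _ ih =>
    have := hinv 0 (by simp) _ ih
    rw [hE] at this
    simpa using (Submodule.add_mem_iff_left _ (V.smul_mem _ (by simpa using ih))).1 this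

/-- An invariant subspace containing the vector of degree `0` contains vectors with lowest term in
every odd negative degree. -/
lemma exists_odd_lowest_term [CharZero K]
    (hE : ∀ n j : ℤ, E n (w j) = w (j + 1 + 2 * n) + ((j / 2 : ℤ) : K) • w (j + 2 * n))
    {V : Submodule K N} (hinv : ∀ i ∈ ({-1, 0, 1} : Set ℤ), ∀ x ∈ V, E i x ∈ V) (h0 : w 0 ∈ V)
    (k : ℕ) :
    ∃ y ∈ Submodule.span K (w '' Set.Ici (-2 * k : ℤ)), w (-2 * k - 1) + y ∈ V := by
  induction k with
  | zero => exact ⟨0, zero_mem _, by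
      simpa using span_Ici_le hE hinv h0 (mem_span_image (by simp : (-1 : ℤ) ∈ Set.Ici (-1)))⟩
  | succ k ih =>
    obtain ⟨y, hy, hyV⟩ := ih
    have hfloor : (-2 * (k : ℤ) - 1) / 2 = -(k + 1) := by omega
    have hk : (-(k + 1) : K) ≠ 0 := neg_ne_zero.2 (by exact_mod_cast k.succ_ne_zero)
    refine ⟨(-(k + 1) : K)⁻¹ • (w (-2 * k - 2) + E (-1) y), Submodule.smul_mem _ _ (add_mem
      (mem_span_image ?_) (map_mem_of_mem_span_image (fun j hj => ?_) hy)), ?_⟩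
    · simp only [Set.mem_Ici]; push_cast; omega
    · simp only [Set.mem_Ici] at hj
      rw [hE]
      refine add_mem (mem_span_image ?_) (Submodule.smul_mem _ _ (mem_span_image ?_)) <;>
      · simp only [Set.mem_Ici]; push_cast; omega
    · have := V.smul_mem (-(k + 1) : K)⁻¹ (hinv (-1) (by simp) _ hyV)
      rw [map_add, hE, hfloor] at this
      rw [show (-2 * k - 1 + 1 + 2 * (-1) : ℤ) = -2 * k - 2 by ring,
        show (-2 * k - 1 + 2 * (-1) : ℤ) = -2 * (k + 1 : ℕ) - 1 by push_cast; ring,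
        add_right_comm (w _), add_comm _ (_ • w _), smul_add, smul_smul] at this
      push_cast at this ⊢
      rwa [inv_mul_cancel₀ hk, one_smul] at this

/-- If `V` is a proper part of an invariant subspace `W`, then `W` contains a vector whose lowest
term has even negative degree. -/
lemma exists_even_lowest_term [CharZero K]
    (hE : ∀ n j : ℤ, E n (w j) = w (j + 1 + 2 * n) + ((j / 2 : ℤ) : K) • w (j + 2 * n))
    {V W : Submodule K N} (hinv : ∀ i ∈ ({-1, 0, 1} : Set ℤ), ∀ x ∈ V, E i x ∈ V) (h0 : w 0 ∈ V)
    (hVW : V ≤ W) (n : ℕ) {x : N} (hx : x ∈ Submodule.span K (w '' Set.Ici (-1 - n : ℤ)))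
    (hxW : x ∈ W) (hxV : x ∉ V) :
    ∃ k : ℕ, ∃ y ∈ Submodule.span K (w '' Set.Ici (-2 * k - 1 : ℤ)), w (-2 * k - 2) + y ∈ W := by
  induction n generalizing x with
  | zero => exact absurd (span_Ici_le hE hinv h0 (by simpa using hx)) hxV
  | succ n ih =>
    have hs : Set.Ici (-1 - (n + 1 : ℕ) : ℤ) ⊆ insert (-1 - (n + 1 : ℕ) : ℤ) (Set.Ici (-1 - n)) := by
      intro j hj
      simp only [Set.mem_insert_iff, Set.mem_Ici] at hj ⊢
      omega
    obtain ⟨c, y, hy, rfl⟩ := exists_smul_add_of_mem_span_image hs hx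
    by_cases hc : c = 0
    · simp only [hc, zero_smul, zero_add] at hxW hxV
      exact ih hy hxW hxV
    obtain ⟨k, rfl | rfl⟩ := n.even_or_odd'
    · refine ⟨k, c⁻¹ • y, Submodule.smul_mem _ _ ?_, ?_⟩
      · convert hy using 4
        push_cast
        ring
      · have := W.smul_mem c⁻¹ hxW
        rw [smul_add, smul_smul, inv_mul_cancel₀ hc, one_smul] at this
        convert this using 3
        push_cast
        ring
    · obtain ⟨z, hz, hzV⟩ := exists_odd_lowest_term hE hinv h0 (k + 1)
      have hdeg : (-1 - (2 * k + 1 + 1 : ℕ) : ℤ) = -2 * (k + 1 : ℕ) - 1 := by push_cast; ring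
      have hdeg' : (-1 - (2 * k + 1 : ℕ) : ℤ) = -2 * (k + 1 : ℕ) := by push_cast; ring
      rw [hdeg] at hxW hxV
      have hdiff : y - c • z = (c • w (-2 * (k + 1 : ℕ) - 1) + y) -
          c • (w (-2 * (k + 1 : ℕ) - 1) + z) := by module
      refine ih (x := y - c • z) (sub_mem hy (Submodule.smul_mem _ _ (by rwa [hdeg']))) ?_ ?_
      · rw [hdiff]
        exact sub_mem hxW (W.smul_mem _ (hVW hzV))
      · rw [hdiff]
        exact fun h => hxV ((Submodule.sub_mem_iff_left _ (V.smul_mem _ hzV)).1 h)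

/-- A vector whose lowest term has even negative degree yields, under `E₁`, the vector of
degree `-2`. -/
lemma degree_neg_two_mem [CharZero K]
    (hE : ∀ n j : ℤ, E n (w j) = w (j + 1 + 2 * n) + ((j / 2 : ℤ) : K) • w (j + 2 * n))
    {W : Submodule K N} (hinv : ∀ i ∈ ({-1, 0, 1} : Set ℤ), ∀ x ∈ W, E i x ∈ W) (h0 : w 0 ∈ W)
    (k : ℕ) {y : N} (hy : y ∈ Submodule.span K (w '' Set.Ici (-2 * k - 1 : ℤ)))
    (hyW : w (-2 * k - 2) + y ∈ W) : w (-2) ∈ W := by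
  induction k generalizing y with
  | zero =>
    have := span_Ici_le hE hinv h0 (by simpa using hy)
    simpa using (Submodule.add_mem_iff_left _ this).1 hyW
  | succ k ih =>
    have hfloor : (-2 * ((k + 1 : ℕ) : ℤ) - 2) / 2 = -(k + 2) := by omega
    have hk : (-(k + 2) : K) ≠ 0 := neg_ne_zero.2 (by exact_mod_cast (k + 1).succ_ne_zero)
    refine ih (y := (-(k + 2) : K)⁻¹ • (w (-2 * k - 1) + E 1 y)) (Submodule.smul_mem _ _ (add_mem
      (mem_span_image (by simp)) (map_mem_of_mem_span_image (fun j hj => ?_) hy))) ?_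
    · simp only [Set.mem_Ici] at hj
      rw [hE]
      refine add_mem (mem_span_image ?_) (Submodule.smul_mem _ _ (mem_span_image ?_)) <;>
      · simp only [Set.mem_Ici]; push_cast at *; omega
    · have := W.smul_mem (-(k + 2) : K)⁻¹ (hinv 1 (by simp) _ hyW)
      rw [map_add, hE, hfloor,
        show (-2 * (k + 1 : ℕ) - 2 + 1 + 2 * 1 : ℤ) = -2 * k - 1 by push_cast; ring,
        show (-2 * (k + 1 : ℕ) - 2 + 2 * 1 : ℤ) = -2 * k - 2 by push_cast; ring,
        add_right_comm (w _), add_comm _ (_ • w _), smul_add, smul_smul] at this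
      push_cast at this
      rwa [inv_mul_cancel₀ hk, one_smul] at this

lemma eq_top_of_degree_neg_two_mem [CharZero K]
    (hE : ∀ n j : ℤ, E n (w j) = w (j + 1 + 2 * n) + ((j / 2 : ℤ) : K) • w (j + 2 * n))
    (htop : Submodule.span K (Set.range w) = ⊤) {W : Submodule K N}
    (hinv : ∀ i ∈ ({-1, 0, 1} : Set ℤ), ∀ x ∈ W, E i x ∈ W) (h0 : w 0 ∈ W) (h2 : w (-2) ∈ W) :
    W = ⊤ := by
  have hge : ∀ j : ℤ, -1 ≤ j → w j ∈ W := fun j hj =>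
    span_Ici_le hE hinv h0 (mem_span_image (Set.mem_Ici.2 hj))
  have hneg : ∀ n : ℕ, w (-1 - n) ∈ W ∧ w (-2 - n) ∈ W := by
    intro n
    induction n with
    | zero => exact ⟨by simpa using hge _ le_rfl, by simpa using h2⟩
    | succ n ih =>
      have h := hinv (-1) (by simp) _ ih.1
      have hne : (((-1 - n : ℤ) / 2 : ℤ) : K) ≠ 0 := Int.cast_ne_zero.2 (by omega)
      rw [hE, show (-1 - n + 1 + 2 * (-1) : ℤ) = -2 - n by ring,
        show (-1 - n + 2 * (-1) : ℤ) = -2 - (n + 1 : ℕ) by push_cast; ring] at h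
      refine ⟨?_, (Submodule.smul_mem_iff _ hne).1 ((Submodule.add_mem_iff_right _ ih.2).1 h)⟩
      convert ih.2 using 2
      push_cast
      ring
  rw [eq_top_iff, ← htop, Submodule.span_le]
  rintro _ ⟨j, rfl⟩
  by_cases hj : -1 ≤ j
  · exact hge j hj
  · have := (hneg (-1 - j).toNat).1
    rwa [show (-1 - ((-1 - j).toNat : ℤ)) = j by omega] at this

/-- An invariant subspace strictly containing an invariant subspace through the vector of
degree `0` is everything. -/
lemma eq_top_of_lt [CharZero K]
    (hE : ∀ n j : ℤ, E n (w j) = w (j + 1 + 2 * n) + ((j / 2 : ℤ) : K) • w (j + 2 * n))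
    (htop : Submodule.span K (Set.range w) = ⊤) {V W : Submodule K N}
    (hVinv : ∀ i ∈ ({-1, 0, 1} : Set ℤ), ∀ x ∈ V, E i x ∈ V)
    (hWinv : ∀ i ∈ ({-1, 0, 1} : Set ℤ), ∀ x ∈ W, E i x ∈ W) (h0 : w 0 ∈ V) (hVW : V < W) :
    W = ⊤ := by
  obtain ⟨x, hxW, hxV⟩ := SetLike.exists_of_lt hVW
  have hx : ∃ n : ℕ, x ∈ Submodule.span K (w '' Set.Ici (-1 - n : ℤ)) := by
    obtain ⟨a, b, hab, c, -, y, hy, rfl⟩ := exists_leading_term htop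
      (fun h => hxV (h ▸ V.zero_mem) : x ≠ 0)
    refine ⟨a.natAbs, add_mem (Submodule.smul_mem _ _ (mem_span_image ?_))
      (Submodule.span_mono (Set.image_mono fun j hj => ?_) hy)⟩
    · simp only [Set.mem_Ici]; omega
    · simp only [Set.mem_Ico, Set.mem_Ici] at hj ⊢; omega
  obtain ⟨n, hn⟩ := hx
  obtain ⟨k, y, hy, hyW⟩ := exists_even_lowest_term hE hVinv h0 hVW.le n hn hxW hxV
  exact eq_top_of_degree_neg_two_mem hE htop hWinv (hVW.le h0)
    (degree_neg_two_mem hE hWinv (hVW.le h0) k hy hyW)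

end Ladder

/-- The vectors `v_k` and `u_k` arranged in a single sequence: `v_k` has degree `2 * k` and `u_k`
has degree `2 * k + 1`. -/
def ladder (K : Type*) [Field K] (j : ℤ) : (ℤ ⊕ ℤ) →₀ K :=
  if j % 2 = 0 then vv K (j / 2) else uu K (j / 2)

lemma ladder_two_mul (K : Type*) [Field K] (k : ℤ) : ladder K (2 * k) = vv K k := by
  simp [ladder]

lemma ladder_two_mul_add_one (K : Type*) [Field K] (k : ℤ) : ladder K (2 * k + 1) = uu K k := by
  rw [ladder, if_neg (by omega), show (2 * k + 1) / 2 = k by omega]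

lemma span_range_ladder (K : Type*) [Field K] :
    Submodule.span K (Set.range (ladder K)) = ⊤ := by
  rw [eq_top_iff, ← (Finsupp.basisSingleOne (R := K) (ι := ℤ ⊕ ℤ)).span_eq, Submodule.span_le]
  rintro _ ⟨k | k, rfl⟩
  · exact Submodule.subset_span ⟨2 * k, by simp [ladder_two_mul, vv]⟩
  · exact Submodule.subset_span ⟨2 * k + 1, by simp [ladder_two_mul_add_one, uu]⟩

/-- Every subspace of `N(0)` invariant under `E_{-1}`, `E_0` and `E_1` equals `0`,
`M`, or `N(0)`; in particular `M` is the unique nonzero proper `sl₂`-submodule. -/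
theorem Nzero_sl2_submodules (K : Type*) [Field K] [CharZero K] [IsAlgClosed K]
    (E : ℤ → (((ℤ ⊕ ℤ) →₀ K) →ₗ[K] ((ℤ ⊕ ℤ) →₀ K)))
    (hEv : ∀ n k : ℤ, E n (vv K k) = (k : K) • vv K (n + k) + uu K (n + k))
    (hEu : ∀ n k : ℤ, E n (uu K k) = (k : K) • uu K (n + k) + vv K (n + k + 1)) :
    ∀ W : Submodule K ((ℤ ⊕ ℤ) →₀ K),
      (∀ i ∈ ({-1, 0, 1} : Set ℤ), ∀ x ∈ W, E i x ∈ W) →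
      W = ⊥ ∨ W = Msub K E ∨ W = ⊤ := by
  intro W hW
  have hE : ∀ n j : ℤ, E n (ladder K j) =
      ladder K (j + 1 + 2 * n) + ((j / 2 : ℤ) : K) • ladder K (j + 2 * n) := by
    intro n j
    obtain ⟨k, rfl | rfl⟩ := j.even_or_odd'
    · rw [show 2 * k + 1 + 2 * n = 2 * (n + k) + 1 by ring,
        show 2 * k + 2 * n = 2 * (n + k) by ring, show 2 * k / 2 = k by omega]
      simp only [ladder_two_mul, ladder_two_mul_add_one, hEv]
      exact add_comm _ _
    · rw [show 2 * k + 1 + 1 + 2 * n = 2 * (n + k + 1) by ring,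
        show 2 * k + 1 + 2 * n = 2 * (n + k) + 1 by ring, show (2 * k + 1) / 2 = k by omega]
      simp only [ladder_two_mul, ladder_two_mul_add_one, hEu]
      exact add_comm _ _
  have hl0 : ladder K 0 = vv K 0 := ladder_two_mul K 0
  have htop := span_range_ladder K
  by_cases hbot : W = ⊥
  · exact Or.inl hbot
  have hle : Msub K E ≤ W :=
    sInf_le ⟨hl0 ▸ degree_zero_mem_of_ne_bot hE htop hW hbot, hW⟩
  have h0 : ladder K 0 ∈ Msub K E := by
    rw [hl0, Msub, Submodule.mem_sInf]
    exact fun V hV => hV.1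
  have hM : ∀ i ∈ ({-1, 0, 1} : Set ℤ), ∀ x ∈ Msub K E, E i x ∈ Msub K E := by
    intro i hi x hx
    rw [Msub, Submodule.mem_sInf] at hx ⊢
    exact fun V hV => hV.2 i hi x (hx V hV)
  rcases hle.eq_or_lt with h | h
  · exact Or.inr (Or.inl h.symm)
  · exact Or.inr (Or.inr (eq_top_of_lt hE htop hM hW h0 h))
end
end

section
/- The operator E_1 on N(0) is injective, and for every nonzero w ∈ N(0) there exists an integer m ≥ 0 such that E_1^m w lies in N_+ = span{v_k, u_k : k ≥ 0}. -/
noncomputable section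

theorem single_inl_eq_smul_vv {K : Type*} [Field K] (k : ℤ) (c : K) :
    (Finsupp.single (Sum.inl k) c : (ℤ ⊕ ℤ) →₀ K) = c • vv K k := by
  simp [vv]

theorem single_inr_eq_smul_uu {K : Type*} [Field K] (k : ℤ) (c : K) :
    (Finsupp.single (Sum.inr k) c : (ℤ ⊕ ℤ) →₀ K) = c • uu K k := by
  simp [uu]

section

variable {K : Type*} [Field K] {T : ((ℤ ⊕ ℤ) →₀ K) →ₗ[K] ((ℤ ⊕ ℤ) →₀ K)}

/-- The coordinates of `T w`, for `T` acting on the basis as `E_1` does. -/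
theorem shift_apply
    (hv : ∀ k : ℤ, T (vv K k) = (k : K) • vv K (k + 1) + uu K (k + 1))
    (hu : ∀ k : ℤ, T (uu K k) = (k : K) • uu K (k + 1) + vv K (k + 2))
    (w : (ℤ ⊕ ℤ) →₀ K) (k : ℤ) :
    T w (Sum.inl (k + 1)) = (k : K) * w (Sum.inl k) + w (Sum.inr (k - 1)) ∧
    T w (Sum.inr (k + 1)) = w (Sum.inl k) + (k : K) * w (Sum.inr k) := by
  induction w using Finsupp.induction_linear with
  | zero => simp
  | add f g hf hg =>
    simp only [map_add, Finsupp.add_apply, hf.1, hf.2, hg.1, hg.2]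
    constructor <;> ring
  | single i c =>
    rcases i with j | j
    · rw [single_inl_eq_smul_vv, map_smul, hv]
      by_cases h : j = k
      · subst h; simp [vv, uu, mul_comm]
      · simp [vv, uu, h]
    · rw [single_inr_eq_smul_uu, map_smul, hu]
      have h1 : j + 2 = k + 1 ↔ j = k - 1 := by omega
      by_cases h : j = k
      · subst h; simp [vv, uu, mul_comm]
      · simp [vv, uu, h, Finsupp.single_apply, h1]

theorem shift_injective
    (hv : ∀ k : ℤ, T (vv K k) = (k : K) • vv K (k + 1) + uu K (k + 1))
    (hu : ∀ k : ℤ, T (uu K k) = (k : K) • uu K (k + 1) + vv K (k + 2)) :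
    Function.Injective T := by
  rw [injective_iff_map_eq_zero]
  intro w hw
  have ha (k : ℤ) : (k : K) * w (Sum.inl k) + w (Sum.inr (k - 1)) = 0 := by
    rw [← (shift_apply hv hu w k).1, hw, Finsupp.zero_apply]
  have hb (k : ℤ) : w (Sum.inl k) + (k : K) * w (Sum.inr k) = 0 := by
    rw [← (shift_apply hv hu w k).2, hw, Finsupp.zero_apply]
  have hfin : {k : ℤ | w (Sum.inr k) ≠ 0}.Finite :=
    w.hasFiniteSupport.preimage Sum.inr_injective.injOn
  obtain ⟨N, hN⟩ := hfin.bddAbove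
  have htop (k : ℤ) (hk : N < k) : w (Sum.inr k) = 0 := by
    by_contra h
    exact absurd (hN h) (not_le.mpr hk)
  have hdown (n : ℕ) : w (Sum.inr (N + 1 - n)) = 0 := by
    induction n with
    | zero => exact htop _ (by simp)
    | succ n ih =>
      have h1 := hb (N + 1 - n)
      have h2 := ha (N + 1 - n)
      rw [ih, mul_zero, add_zero] at h1
      rw [h1, mul_zero, zero_add] at h2
      rw [← h2]
      congr 2
      push_cast
      ring
  have hr (k : ℤ) : w (Sum.inr k) = 0 := by
    rcases lt_or_ge N k with h | h
    · exact htop k h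
    · have := hdown (N + 1 - k).toNat
      rwa [Int.toNat_of_nonneg (by omega), sub_sub_cancel] at this
  ext i
  rcases i with k | k
  · simpa [hr] using hb k
  · exact hr k

theorem shift_pow_mem {P : Submodule K ((ℤ ⊕ ℤ) →₀ K)}
    (hv : ∀ k : ℤ, T (vv K k) = (k : K) • vv K (k + 1) + uu K (k + 1))
    (hu : ∀ k : ℤ, T (uu K k) = (k : K) • uu K (k + 1) + vv K (k + 2))
    (hPv : ∀ k : ℤ, 0 ≤ k → vv K k ∈ P) (hPu : ∀ k : ℤ, 0 ≤ k → uu K k ∈ P)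
    (m : ℕ) (k : ℤ) (hk : 0 ≤ k + m) :
    (T ^ m) (vv K k) ∈ P ∧ (T ^ m) (uu K k) ∈ P := by
  induction m generalizing k with
  | zero => exact ⟨hPv k (by simpa using hk), hPu k (by simpa using hk)⟩
  | succ m ih =>
    push_cast at hk
    have h1 := ih (k + 1) (by omega)
    have h2 := ih (k + 2) (by omega)
    simp only [pow_succ, Module.End.mul_apply, hv, hu, map_add, map_smul]
    exact ⟨P.add_mem (P.smul_mem _ h1.1) h1.2, P.add_mem (P.smul_mem _ h1.2) h2.1⟩

theorem exists_forall_shift_pow_mem {P : Submodule K ((ℤ ⊕ ℤ) →₀ K)}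
    (hv : ∀ k : ℤ, T (vv K k) = (k : K) • vv K (k + 1) + uu K (k + 1))
    (hu : ∀ k : ℤ, T (uu K k) = (k : K) • uu K (k + 1) + vv K (k + 2))
    (hPv : ∀ k : ℤ, 0 ≤ k → vv K k ∈ P) (hPu : ∀ k : ℤ, 0 ≤ k → uu K k ∈ P)
    (w : (ℤ ⊕ ℤ) →₀ K) : ∃ N : ℕ, ∀ m ≥ N, (T ^ m) w ∈ P := by
  induction w using Finsupp.induction_linear with
  | zero => exact ⟨0, fun m _ => by simp⟩
  | add f g hf hg =>
    obtain ⟨M, hM⟩ := hf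
    obtain ⟨N, hN⟩ := hg
    refine ⟨max M N, fun m hm => ?_⟩
    rw [map_add]
    exact P.add_mem (hM m (le_of_max_le_left hm)) (hN m (le_of_max_le_right hm))
  | single i c =>
    rcases i with k | k
    · refine ⟨(-k).toNat, fun m hm => ?_⟩
      rw [single_inl_eq_smul_vv, map_smul]
      exact P.smul_mem _ (shift_pow_mem hv hu hPv hPu m k (by omega)).1
    · refine ⟨(-k).toNat, fun m hm => ?_⟩
      rw [single_inr_eq_smul_uu, map_smul]
      exact P.smul_mem _ (shift_pow_mem hv hu hPv hPu m k (by omega)).2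

end

/-- The operator `E_1` on `N(0)` is injective, and every nonzero `w ∈ N(0)` is moved
into `N_+ = span{v_k, u_k : k ≥ 0}` by a high enough power of `E_1`. -/
theorem Nzero_E1_injective_and_positivizes (K : Type*) [Field K] [CharZero K]
    [IsAlgClosed K]
    (E : ℤ → (((ℤ ⊕ ℤ) →₀ K) →ₗ[K] ((ℤ ⊕ ℤ) →₀ K)))
    (hEv : ∀ n k : ℤ, E n (vv K k) = (k : K) • vv K (n + k) + uu K (n + k))
    (hEu : ∀ n k : ℤ, E n (uu K k) = (k : K) • uu K (n + k) + vv K (n + k + 1)) :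
    Function.Injective (E 1) ∧
    ∀ w : (ℤ ⊕ ℤ) →₀ K, w ≠ 0 →
      ∃ m : ℕ, ((E 1) ^ m) w ∈
        Submodule.span K
          ((Set.range fun k : ℕ => vv K (k : ℤ))
            ∪ (Set.range fun k : ℕ => uu K (k : ℤ))) := by
  have hv (k : ℤ) : E 1 (vv K k) = (k : K) • vv K (k + 1) + uu K (k + 1) := by
    rw [hEv, add_comm 1 k]
  have hu (k : ℤ) : E 1 (uu K k) = (k : K) • uu K (k + 1) + vv K (k + 2) := by
    rw [hEu, add_comm 1 k, add_assoc, one_add_one_eq_two]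
  refine ⟨shift_injective hv hu, fun w _ => ?_⟩
  obtain ⟨N, hN⟩ := exists_forall_shift_pow_mem (P := Submodule.span K
      ((Set.range fun k : ℕ => vv K (k : ℤ)) ∪ (Set.range fun k : ℕ => uu K (k : ℤ)))) hv hu
    (fun k hk => Submodule.subset_span (Or.inl ⟨k.toNat, by simp [hk]⟩))
    (fun k hk => Submodule.subset_span (Or.inr ⟨k.toNat, by simp [hk]⟩)) w
  exact ⟨N, hN N le_rfl⟩
end
end

section
/- N(0) is the internal direct sum of M and the subspace span{v_{-k} : k ≥ 1}; that is, M ∩ span{v_{-k} : k ≥ 1} = 0 and M + span{v_{-k} : k ≥ 1} = N(0). Moreover E_1 v_{-1} ∈ M and E_0 v_{-1} + v_{-1} ∈ M, so the image of v_{-1} in the quotient N(0)/M is a highest weight vector of weight −1. -/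
noncomputable section

open Submodule

/-- The coefficients of the series `∑ tⁿ / (n!)²`, extended by zero to negative indices. -/
def besselCoeff (K : Type*) [Field K] (m : ℤ) : K :=
  if 0 ≤ m then (((m.toNat).factorial : K) ^ 2)⁻¹ else 0

theorem besselCoeff_of_neg (K : Type*) [Field K] {m : ℤ} (hm : m < 0) :
    besselCoeff K m = 0 := by
  simp [besselCoeff, not_le.2 hm]

theorem besselCoeff_zero (K : Type*) [Field K] : besselCoeff K 0 = 1 := by
  simp [besselCoeff]

theorem sq_mul_besselCoeff (K : Type*) [Field K] [CharZero K] (m : ℤ) :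
    (m : K) * (m * besselCoeff K m) = besselCoeff K (m - 1) := by
  rcases lt_trichotomy m 0 with h | rfl | h
  · rw [besselCoeff_of_neg K h, besselCoeff_of_neg K (by lia)]
    simp
  · rw [besselCoeff_of_neg K (by lia : (0 : ℤ) - 1 < 0)]
    simp
  · obtain ⟨n, rfl⟩ : ∃ n : ℕ, m = n + 1 := ⟨(m - 1).toNat, by lia⟩
    have h1 : (0 : ℤ) ≤ n + 1 := by lia
    have h2 : ((n : ℤ) + 1).toNat = n + 1 := by lia
    have h3 : (n : K) + 1 ≠ 0 := Nat.cast_add_one_ne_zero n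
    have h4 : (n.factorial : K) ≠ 0 := Nat.cast_ne_zero.2 n.factorial_ne_zero
    simp only [besselCoeff, h1, h2, add_sub_cancel_right, Nat.cast_nonneg, if_true,
      Int.toNat_natCast, Nat.factorial_succ]
    push_cast
    field_simp

/-- The coefficient of `t⁻ʲ` under `v_k ↦ tᵏ f`, `u_k ↦ tᵏ⁺¹ f'`, where `f = ∑ tⁿ / (n!)²`. -/
def coeffFunctional (K : Type*) [Field K] (j : ℤ) : ((ℤ ⊕ ℤ) →₀ K) →ₗ[K] K :=
  Finsupp.linearCombination K (Sum.elim (fun k => besselCoeff K (-j - k))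
    (fun k => ((-j - k : ℤ) : K) * besselCoeff K (-j - k)))

theorem coeffFunctional_vv (K : Type*) [Field K] (j k : ℤ) :
    coeffFunctional K j (vv K k) = besselCoeff K (-j - k) := by
  simp [coeffFunctional, vv]

theorem coeffFunctional_uu (K : Type*) [Field K] (j k : ℤ) :
    coeffFunctional K j (uu K k) = ((-j - k : ℤ) : K) * besselCoeff K (-j - k) := by
  simp [coeffFunctional, uu]

theorem ext_vv_uu {K : Type*} [Field K] {P : Type*} [AddCommMonoid P] [Module K P]
    {f g : ((ℤ ⊕ ℤ) →₀ K) →ₗ[K] P} (hv : ∀ k, f (vv K k) = g (vv K k))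
    (hu : ∀ k, f (uu K k) = g (uu K k)) : f = g := by
  refine Finsupp.lhom_ext' fun i => LinearMap.ext_ring ?_
  rcases i with k | k
  · exact hv k
  · exact hu k

theorem eq_top_of_vv_uu_mem {K : Type*} [Field K] {W : Submodule K ((ℤ ⊕ ℤ) →₀ K)}
    (hv : ∀ k, vv K k ∈ W) (hu : ∀ k, uu K k ∈ W) : W = ⊤ := by
  rw [← W.ker_mkQ, LinearMap.ker_eq_top]
  refine ext_vv_uu (fun k => ?_) fun k => ?_
  · simpa using hv k
  · simpa using hu k

section

variable {K : Type*} [Field K] {E : ℤ → (((ℤ ⊕ ℤ) →₀ K) →ₗ[K] ((ℤ ⊕ ℤ) →₀ K))}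

theorem coeffFunctional_apply [CharZero K]
    (hEv : ∀ n k : ℤ, E n (vv K k) = (k : K) • vv K (n + k) + uu K (n + k))
    (hEu : ∀ n k : ℤ, E n (uu K k) = (k : K) • uu K (n + k) + vv K (n + k + 1))
    (j n : ℤ) (x : (ℤ ⊕ ℤ) →₀ K) :
    coeffFunctional K j (E n x) = ((-j - n : ℤ) : K) * coeffFunctional K (j + n) x := by
  suffices h : coeffFunctional K j ∘ₗ E n = ((-j - n : ℤ) : K) • coeffFunctional K (j + n) from
    LinearMap.congr_fun h x
  refine ext_vv_uu (fun k => ?_) fun k => ?_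
  · simp only [LinearMap.comp_apply, LinearMap.smul_apply, hEv, map_add, map_smul, smul_eq_mul,
      coeffFunctional_vv, coeffFunctional_uu, show -(j + n) - k = -j - (n + k) by ring]
    push_cast
    ring
  · have h := sq_mul_besselCoeff K (-j - (n + k))
    simp only [LinearMap.comp_apply, LinearMap.smul_apply, hEu, map_add, map_smul, smul_eq_mul,
      coeffFunctional_vv, coeffFunctional_uu, show -(j + n) - k = -j - (n + k) by ring,
      show -j - (n + k + 1) = -j - (n + k) - 1 by ring, ← h]
    push_cast
    ring

theorem vv_zero_mem_Msub : vv K 0 ∈ Msub K E :=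
  Submodule.mem_sInf.2 fun _ hW => hW.1

theorem apply_mem_Msub {i : ℤ} (hi : i ∈ ({-1, 0, 1} : Set ℤ)) {x : (ℤ ⊕ ℤ) →₀ K}
    (hx : x ∈ Msub K E) : E i x ∈ Msub K E :=
  Submodule.mem_sInf.2 fun W hW => hW.2 i hi x (Submodule.mem_sInf.1 hx W hW)

theorem coeffFunctional_eq_zero_of_mem_Msub [CharZero K]
    (hEv : ∀ n k : ℤ, E n (vv K k) = (k : K) • vv K (n + k) + uu K (n + k))
    (hEu : ∀ n k : ℤ, E n (uu K k) = (k : K) • uu K (n + k) + vv K (n + k + 1))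
    {x : (ℤ ⊕ ℤ) →₀ K} (hx : x ∈ Msub K E) {j : ℤ} (hj : 1 ≤ j) :
    coeffFunctional K j x = 0 := by
  let W : Submodule K ((ℤ ⊕ ℤ) →₀ K) :=
    ⨅ j : Set.Ici (1 : ℤ), LinearMap.ker (coeffFunctional K (j : ℤ))
  have mem_W {y : (ℤ ⊕ ℤ) →₀ K} : y ∈ W ↔ ∀ j : ℤ, 1 ≤ j → coeffFunctional K j y = 0 := by
    simp [W]
  refine mem_W.1 (Submodule.mem_sInf.1 hx W ⟨mem_W.2 fun j hj => ?_,
    fun i hi y hy => mem_W.2 fun j hj => ?_⟩) j hj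
  · rw [coeffFunctional_vv, besselCoeff_of_neg K (by lia)]
  · rw [coeffFunctional_apply hEv hEu]
    rcases eq_or_ne (-j - i) 0 with h | h
    · simp [h]
    · rw [mem_W.1 hy (j + i) ?_, mul_zero]
      rcases hi with rfl | rfl | rfl <;> lia

theorem eq_zero_of_mem_span_vv {x : (ℤ ⊕ ℤ) →₀ K}
    (hx : x ∈ span K (Set.range fun k : ℕ => vv K (-(k : ℤ) - 1)))
    (h : ∀ j : ℤ, 1 ≤ j → coeffFunctional K j x = 0) : x = 0 := by
  obtain ⟨c, rfl⟩ := Finsupp.mem_span_range_iff_exists_finsupp.1 hx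
  suffices hc : c = 0 by simp [hc]
  by_contra hc
  have hne := Finsupp.support_nonempty_iff.2 hc
  set n := c.support.max' hne
  have hn : n ∈ c.support := c.support.max'_mem hne
  have key := h (n + 1) (by lia)
  rw [Finsupp.sum, map_sum, Finset.sum_eq_single_of_mem n hn, map_smul, coeffFunctional_vv,
    show -((n : ℤ) + 1) - (-(n : ℤ) - 1) = 0 by ring, besselCoeff_zero] at key
  · exact Finsupp.mem_support_iff.1 hn (by simpa using key)
  · intro k hk hkn
    have : k ≤ n := c.support.le_max' k hk
    rw [map_smul, coeffFunctional_vv, besselCoeff_of_neg K (by lia), smul_zero]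

theorem uu_mem_Msub_of_vv_mem
    (hEv : ∀ n k : ℤ, E n (vv K k) = (k : K) • vv K (n + k) + uu K (n + k))
    {k : ℤ} (h : vv K k ∈ Msub K E) : uu K k ∈ Msub K E := by
  have h' := apply_mem_Msub (i := 0) (by simp) h
  rw [hEv, zero_add] at h'
  exact (Submodule.add_mem_iff_right _ (Submodule.smul_mem _ _ h)).1 h'

theorem vv_natCast_mem_Msub
    (hEv : ∀ n k : ℤ, E n (vv K k) = (k : K) • vv K (n + k) + uu K (n + k))
    (hEu : ∀ n k : ℤ, E n (uu K k) = (k : K) • uu K (n + k) + vv K (n + k + 1)) (k : ℕ) :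
    vv K (k : ℤ) ∈ Msub K E := by
  induction k with
  | zero => exact vv_zero_mem_Msub
  | succ k ih =>
    have hu := uu_mem_Msub_of_vv_mem hEv ih
    have h' := apply_mem_Msub (i := 0) (by simp) hu
    rw [hEu, zero_add] at h'
    exact (Submodule.add_mem_iff_right _ (Submodule.smul_mem _ _ hu)).1 h'

theorem uu_neg_one_mem_Msub
    (hEv : ∀ n k : ℤ, E n (vv K k) = (k : K) • vv K (n + k) + uu K (n + k)) :
    uu K (-1) ∈ Msub K E := by
  simpa [hEv] using apply_mem_Msub (i := -1) (by simp) (vv_zero_mem_Msub (E := E))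

theorem uu_neg_mem_Msub_sup [CharZero K]
    (hEv : ∀ n k : ℤ, E n (vv K k) = (k : K) • vv K (n + k) + uu K (n + k))
    (hEu : ∀ n k : ℤ, E n (uu K k) = (k : K) • uu K (n + k) + vv K (n + k + 1)) (n : ℕ) :
    uu K (-(n : ℤ) - 1) ∈
      Msub K E ⊔ span K ((fun k : ℕ => vv K (-(k : ℤ) - 1)) '' Set.Iio n) := by
  induction n using Nat.strong_induction_on with
  | _ n ih =>
  rcases n with _ | n
  · simpa using uu_neg_one_mem_Msub hEv
  set T : ℕ → Submodule K ((ℤ ⊕ ℤ) →₀ K) := fun m =>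
    Msub K E ⊔ span K ((fun k : ℕ => vv K (-(k : ℤ) - 1)) '' Set.Iio m)
  have T_mono {a b : ℕ} (hab : a ≤ b) : T a ≤ T b :=
    sup_le_sup_left (span_mono (Set.image_mono (Set.Iio_subset_Iio hab))) _
  have vv_mem {k m : ℕ} (h : k < m) : vv K (-(k : ℤ) - 1) ∈ T m :=
    Submodule.mem_sup_right (subset_span ⟨k, h, rfl⟩)
  have maps : T n ≤ (T (n + 1)).comap (E (-1)) := by
    refine sup_le (fun x hx => Submodule.mem_sup_left (apply_mem_Msub (by simp) hx))
      (span_le.2 ?_)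
    rintro _ ⟨k, hk, rfl⟩
    have hk : k < n := hk
    have hu := T_mono (by lia : k + 1 ≤ n + 1) (ih (k + 1) (by lia))
    have hv := vv_mem (by lia : k + 1 < n + 1)
    have e : (-1 : ℤ) + (-(k : ℤ) - 1) = -((k + 1 : ℕ) : ℤ) - 1 := by push_cast; ring
    simp only [SetLike.mem_coe, Submodule.mem_comap, hEv, e]
    exact Submodule.add_mem _ (Submodule.smul_mem _ _ hv) hu
  have h := maps (ih n (by lia))
  rw [Submodule.mem_comap, hEu, show (-1 : ℤ) + (-(n : ℤ) - 1) + 1 = -(n : ℤ) - 1 by ring,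
    show (-1 : ℤ) + (-(n : ℤ) - 1) = -((n + 1 : ℕ) : ℤ) - 1 by push_cast; ring] at h
  have h' := (Submodule.add_mem_iff_left _ (vv_mem n.lt_succ_self)).1 h
  exact (Submodule.smul_mem_iff _ (Int.cast_ne_zero.2 (by lia))).1 h'

end

/-- `N(0)` is the internal direct sum of `M` and `span{v_{-k} : k ≥ 1}`; moreover
`E_1 v_{-1} ∈ M` and `E_0 v_{-1} + v_{-1} ∈ M`, so the image of `v_{-1}` in `N(0)/M`
is a highest weight vector of weight `−1`. -/
theorem Nzero_direct_sum_decomposition (K : Type*) [Field K] [CharZero K]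
    [IsAlgClosed K]
    (E : ℤ → (((ℤ ⊕ ℤ) →₀ K) →ₗ[K] ((ℤ ⊕ ℤ) →₀ K)))
    (hEv : ∀ n k : ℤ, E n (vv K k) = (k : K) • vv K (n + k) + uu K (n + k))
    (hEu : ∀ n k : ℤ, E n (uu K k) = (k : K) • uu K (n + k) + vv K (n + k + 1)) :
    Msub K E ⊓ Submodule.span K
        (Set.range fun k : ℕ => vv K (-(k : ℤ) - 1)) = ⊥ ∧
    Msub K E ⊔ Submodule.span K
        (Set.range fun k : ℕ => vv K (-(k : ℤ) - 1)) = ⊤ ∧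
    E 1 (vv K (-1)) ∈ Msub K E ∧
    E 0 (vv K (-1)) + vv K (-1) ∈ Msub K E := by
  refine ⟨?_, ?_, ?_, ?_⟩
  · rw [Submodule.eq_bot_iff]
    rintro x ⟨hM, hV⟩
    exact eq_zero_of_mem_span_vv hV fun j hj =>
      coeffFunctional_eq_zero_of_mem_Msub hEv hEu hM hj
  · refine eq_top_of_vv_uu_mem (fun k => ?_) fun k => ?_ <;> rcases le_or_gt 0 k with hk | hk
    · lift k to ℕ using hk
      exact Submodule.mem_sup_left (vv_natCast_mem_Msub hEv hEu k)
    · obtain ⟨n, rfl⟩ : ∃ n : ℕ, k = -(n : ℤ) - 1 := ⟨(-k - 1).toNat, by lia⟩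
      exact Submodule.mem_sup_right (subset_span ⟨n, rfl⟩)
    · lift k to ℕ using hk
      exact Submodule.mem_sup_left (uu_mem_Msub_of_vv_mem hEv (vv_natCast_mem_Msub hEv hEu k))
    · obtain ⟨n, rfl⟩ : ∃ n : ℕ, k = -(n : ℤ) - 1 := ⟨(-k - 1).toNat, by lia⟩
      have hle : span K ((fun k : ℕ => vv K (-(k : ℤ) - 1)) '' Set.Iio n) ≤
          span K (Set.range fun k : ℕ => vv K (-(k : ℤ) - 1)) :=
        span_mono (Set.image_subset_range _ _)
      have hsup := sup_le_sup_left hle (Msub K E)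
      exact hsup (uu_neg_mem_Msub_sup hEv hEu n)
  · have h0 : vv K 0 ∈ Msub K E := vv_zero_mem_Msub
    rw [hEv, show (1 : ℤ) + -1 = 0 by ring]
    exact Submodule.add_mem _ (Submodule.smul_mem _ _ h0) (uu_mem_Msub_of_vv_mem hEv h0)
  · simpa [hEv] using uu_neg_one_mem_Msub hEv
end
end

section
/- N(0) is irreducible as a module over the Lie algebra W_1 of vector fields on the circle: every subspace of N(0) that is invariant under the operators E_n for all n ∈ ℤ is equal to 0 or to N(0). -/
noncomputable section

/-- Even integers index the left summand and odd integers the right one. -/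
def evenOddEquiv : ℤ ⊕ ℤ ≃ ℤ where
  toFun := Sum.elim (fun k => 2 * k) (fun k => 2 * k + 1)
  invFun j := if j % 2 = 0 then Sum.inl (j / 2) else Sum.inr (j / 2)
  left_inv := by
    rintro (k | k)
    · simp
    · have h : (2 * k + 1) % 2 ≠ 0 := by omega
      have h' : (2 * k + 1) / 2 = k := by omega
      simp only [Sum.elim_inr, if_neg h, h']
  right_inv j := by
    dsimp only
    split_ifs <;> simp only [Sum.elim_inl, Sum.elim_inr] <;> omega

/-- The reindexing of `N(0)` that sends `v_k` to `e_{2k}` and `u_k` to `e_{2k+1}`. -/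
def reindex (K : Type*) [Field K] : ((ℤ ⊕ ℤ) →₀ K) ≃ₗ[K] (ℤ →₀ K) :=
  Finsupp.domLCongr evenOddEquiv

/-- The operator `e_j ↦ ⌊j/2⌋ e_j + e_{j+1}`, which is `E_0` after reindexing. -/
def connection (K : Type*) [Field K] : (ℤ →₀ K) →ₗ[K] (ℤ →₀ K) :=
  Finsupp.linearCombination K fun j =>
    ((j / 2 : ℤ) : K) • Finsupp.single j 1 + Finsupp.single (j + 1) 1

/-- The operator `e_j ↦ e_{j+2n}`. -/
def evenShift (K : Type*) [Field K] (n : ℤ) : (ℤ →₀ K) →ₗ[K] (ℤ →₀ K) :=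
  Finsupp.lmapDomain K K fun j => j + 2 * n

section

variable {K : Type*} [Field K]

theorem connection_single (j : ℤ) :
    connection K (Finsupp.single j 1) =
      ((j / 2 : ℤ) : K) • Finsupp.single j 1 + Finsupp.single (j + 1) 1 := by
  simp [connection]

theorem evenShift_single (n j : ℤ) (c : K) :
    evenShift K n (Finsupp.single j c) = Finsupp.single (j + 2 * n) c := by
  simp [evenShift]

theorem connection_apply (x : ℤ →₀ K) (j : ℤ) :
    connection K x j = ((j / 2 : ℤ) : K) * x j + x (j - 1) := by
  induction x using Finsupp.induction_linear with
  | zero => simp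
  | add x y hx hy =>
    simp only [map_add, Finsupp.add_apply, hx, hy]
    ring
  | single i c =>
    have h : i + 1 = j ↔ i = j - 1 := by omega
    rw [← mul_one c, ← smul_eq_mul, ← Finsupp.smul_single, map_smul, connection_single]
    simp only [Finsupp.smul_apply, Finsupp.add_apply, Finsupp.single_apply, smul_eq_mul, h]
    split_ifs <;> simp_all; ring

theorem evenShift_apply (n : ℤ) (x : ℤ →₀ K) (j : ℤ) :
    evenShift K n x j = x (j - 2 * n) := by
  have h := Finsupp.mapDomain_apply (add_left_injective (2 * n)) x (j - 2 * n)
  rwa [sub_add_cancel] at h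

theorem evenShift_evenShift (m n : ℤ) (x : ℤ →₀ K) :
    evenShift K m (evenShift K n x) = evenShift K (m + n) x := by
  ext j
  simp only [evenShift_apply]
  congr 1
  ring

theorem evenShift_zero (x : ℤ →₀ K) : evenShift K 0 x = x := by
  ext j
  simp [evenShift_apply]

theorem reindex_vv (k : ℤ) : reindex K (vv K k) = Finsupp.single (2 * k) 1 := by
  simp [reindex, vv, evenOddEquiv]

theorem reindex_uu (k : ℤ) : reindex K (uu K k) = Finsupp.single (2 * k + 1) 1 := by
  simp [reindex, uu, evenOddEquiv]

theorem exists_support_max {x : ℤ →₀ K} (hx : x ≠ 0) :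
    ∃ b, x b ≠ 0 ∧ ∀ j, x j ≠ 0 → j ≤ b := by
  have hne := Finsupp.support_nonempty_iff.mpr hx
  exact ⟨x.support.max' hne, Finsupp.mem_support_iff.mp (Finset.max'_mem _ hne),
    fun j hj => Finset.le_max' _ _ (Finsupp.mem_support_iff.mpr hj)⟩

theorem connection_ne_zero {x : ℤ →₀ K} (hx : x ≠ 0) : connection K x ≠ 0 := by
  obtain ⟨b, hb, hmax⟩ := exists_support_max hx
  intro h
  have h0 : x (b + 1) = 0 := by
    by_contra hne
    have := hmax _ hne
    omega
  have h1 := connection_apply x (b + 1)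
  rw [h, h0] at h1
  simp at h1
  exact hb h1.symm

/-- If a submodule stable under `connection` and `evenShift` contains an element whose support lies
in an interval of length `n` and meets its right end, it contains one with `n = 0`. -/
theorem exists_width_zero [CharZero K] (S : Submodule K (ℤ →₀ K))
    (hD : ∀ x ∈ S, connection K x ∈ S) (hT : ∀ n, ∀ x ∈ S, evenShift K n x ∈ S) (n : ℕ) :
    ∀ (a : ℤ), ∀ x ∈ S, x (a + n) ≠ 0 → (∀ j, x j ≠ 0 → a ≤ j ∧ j ≤ a + n) →
      ∃ b, ∃ y ∈ S, y b ≠ 0 ∧ ∀ j, y j ≠ 0 → j = b := by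
  induction n with
  | zero =>
    intro a x hx htop hsupp
    refine ⟨a, x, hx, by simpa using htop, fun j hj => ?_⟩
    have := hsupp j hj
    omega
  | succ n ih =>
    intro a x hx htop hsupp
    have hout : ∀ j, (j < a ∨ a + n + 1 < j) → x j = 0 := by
      intro j hj
      by_contra hne
      have := hsupp j hne
      push_cast at this
      omega
    set y := connection K x - ((a / 2 : ℤ) : K) • x with hy
    set z := connection K y - (((a + 1) / 2 : ℤ) : K) • y - evenShift K 1 x with hz
    have hyS : y ∈ S := S.sub_mem (hD x hx) (S.smul_mem _ hx)
    have hzS : z ∈ S := S.sub_mem (S.sub_mem (hD y hyS) (S.smul_mem _ hyS)) (hT 1 x hx)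
    have hyj : ∀ j, y j = (((j / 2 : ℤ) : K) - ((a / 2 : ℤ) : K)) * x j + x (j - 1) := by
      intro j
      simp only [hy, Finsupp.sub_apply, Finsupp.smul_apply, connection_apply, smul_eq_mul]
      ring
    have hzj : ∀ j, z j = (((j / 2 : ℤ) : K) - (((a + 1) / 2 : ℤ) : K)) * y j + y (j - 1)
        - x (j - 2) := by
      intro j
      simp only [hz, Finsupp.sub_apply, Finsupp.smul_apply, connection_apply, smul_eq_mul,
        evenShift_apply, mul_one]
      ring
    have hylow : ∀ j, j ≤ a → y j = 0 := by
      intro j hj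
      rw [hyj, hout (j - 1) (by omega)]
      rcases hj.eq_or_lt with rfl | h
      · simp
      · simp [hout j (Or.inl h)]
    refine ih (a + 2) z hzS ?_ ?_
    · have e : z (a + 2 + n) = ((n + 1 : ℕ) : K) * x (a + (n + 1 : ℕ)) := by
        have e1 : a + 2 + (n : ℤ) - 1 = a + (n + 1 : ℕ) := by push_cast; ring
        have e2 : a + (n + 1 : ℕ) - 1 = a + 2 + (n : ℤ) - 2 := by push_cast; ring
        have e3 : (a + 2 + (n : ℤ)) / 2 + (a + (n + 1 : ℕ)) / 2
            = (n + 1 : ℕ) + (a + 1) / 2 + a / 2 := by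
          omega
        have e4 := congrArg (Int.cast : ℤ → K) e3
        rw [hzj, hyj (a + 2 + n), e1, hyj (a + (n + 1 : ℕ)), e2,
          hout (a + 2 + n) (by omega)]
        simp only [Int.cast_add, Int.cast_natCast] at e4
        linear_combination x (a + (n + 1 : ℕ)) * e4
      rw [e]
      exact mul_ne_zero (Nat.cast_ne_zero.mpr n.succ_ne_zero) htop
    · intro j hj
      by_contra hcon
      apply hj
      rcases lt_or_ge j (a + 2) with h | h
      · rw [hzj, hylow (j - 1) (by omega), hout (j - 2) (by omega)]
        rcases eq_or_ne j (a + 1) with rfl | h'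
        · simp
        · simp [hylow j (by omega)]
      · rcases eq_or_ne j (a + n + 3) with rfl | h'
        · have e1 : a + (n : ℤ) + 3 - 1 - 1 = a + n + 3 - 2 := by ring
          rw [hzj, hyj, hyj (a + n + 3 - 1), hout (a + n + 3) (by omega),
            hout (a + n + 3 - 1) (by omega), e1]
          simp
        · rw [hzj, hyj, hyj (j - 1), hout j (by omega), hout (j - 1) (by omega),
            hout (j - 1 - 1) (by omega), hout (j - 2) (by omega)]
          simp

theorem eq_top_of_connection_mem_of_evenShift_mem [CharZero K] (S : Submodule K (ℤ →₀ K))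
    (hD : ∀ x ∈ S, connection K x ∈ S) (hT : ∀ n, ∀ x ∈ S, evenShift K n x ∈ S)
    {x : ℤ →₀ K} (hx : x ∈ S) (hx0 : x ≠ 0) : S = ⊤ := by
  obtain ⟨b, y, hyS, hyb, hy⟩ : ∃ b, ∃ y ∈ S, y b ≠ 0 ∧ ∀ j, y j ≠ 0 → j = b := by
    obtain ⟨b, hb, hmax⟩ := exists_support_max hx0
    have hne := Finsupp.support_nonempty_iff.mpr hx0
    have hmin : ∀ j, x j ≠ 0 → x.support.min' hne ≤ j := fun j hj =>
      Finset.min'_le _ _ (Finsupp.mem_support_iff.mpr hj)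
    have hlen : x.support.min' hne + ((b - x.support.min' hne).toNat : ℤ) = b := by
      have := hmin b hb
      omega
    refine exists_width_zero S hD hT (b - x.support.min' hne).toNat (x.support.min' hne) x hx ?_ ?_
    · rwa [hlen]
    · rw [hlen]
      exact fun j hj => ⟨hmin j hj, hmax j hj⟩
  have hb : Finsupp.single b (1 : K) ∈ S := by
    have e : Finsupp.single b (1 : K) = (y b)⁻¹ • y := by
      ext j
      rcases eq_or_ne b j with rfl | h
      · simp [hyb]
      · have : y j = 0 := by
          by_contra hne
          exact h (hy j hne).symm
        simp [this, Finsupp.single_eq_of_ne' h]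
    rw [e]
    exact S.smul_mem _ hyS
  have hb1 : Finsupp.single (b + 1) (1 : K) ∈ S := by
    have h := S.sub_mem (hD _ hb) (S.smul_mem ((b / 2 : ℤ) : K) hb)
    rwa [connection_single, add_sub_cancel_left] at h
  have hall : ∀ j, Finsupp.single j (1 : K) ∈ S := by
    intro j
    rcases Int.even_or_odd' (j - b) with ⟨m, hm | hm⟩
    · have h := hT m _ hb
      rwa [evenShift_single, show b + 2 * m = j by omega] at h
    · have h := hT m _ hb1
      rwa [evenShift_single, show b + 1 + 2 * m = j by omega] at h
  refine Submodule.eq_top_iff'.mpr fun z => ?_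
  induction z using Finsupp.induction_linear with
  | zero => exact S.zero_mem
  | add z w hz hw => exact S.add_mem hz hw
  | single j c =>
    rw [← mul_one c, ← smul_eq_mul, ← Finsupp.smul_single]
    exact S.smul_mem c (hall j)

end

/-- `N(0)` is irreducible as a module over the Lie algebra `W_1` of vector fields on
the circle: every subspace invariant under all the operators `E_n`, `n ∈ ℤ`, is
`0` or `N(0)`. -/
theorem Nzero_W1_irreducible (K : Type*) [Field K] [CharZero K] [IsAlgClosed K]
    (E : ℤ → (((ℤ ⊕ ℤ) →₀ K) →ₗ[K] ((ℤ ⊕ ℤ) →₀ K)))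
    (hEv : ∀ n k : ℤ, E n (vv K k) = (k : K) • vv K (n + k) + uu K (n + k))
    (hEu : ∀ n k : ℤ, E n (uu K k) = (k : K) • uu K (n + k) + vv K (n + k + 1)) :
    ∀ W : Submodule K ((ℤ ⊕ ℤ) →₀ K),
      (∀ n : ℤ, ∀ x ∈ W, E n x ∈ W) → W = ⊥ ∨ W = ⊤ := by
  intro W hW
  have hE : ∀ n x, reindex K (E n x) = evenShift K n (connection K (reindex K x)) := by
    intro n x
    induction x using Finsupp.induction_linear with
    | zero => simp
    | add x y hx hy => simp only [map_add, hx, hy]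
    | single i c =>
      rw [← mul_one c, ← smul_eq_mul, ← Finsupp.smul_single]
      simp only [map_smul]
      congr 1
      rcases i with k | k
      · change reindex K (E n (vv K k)) = evenShift K n (connection K (reindex K (vv K k)))
        rw [hEv, reindex_vv, connection_single, map_add, map_add, map_smul, map_smul, reindex_vv,
          reindex_uu, evenShift_single, evenShift_single]
        rw [show 2 * k / 2 = k by omega, show 2 * (n + k) = 2 * k + 2 * n by ring,
          add_right_comm (2 * k)]
      · change reindex K (E n (uu K k)) = evenShift K n (connection K (reindex K (uu K k)))
        rw [hEu, reindex_uu, connection_single, map_add, map_add, map_smul, map_smul, reindex_uu,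
          reindex_vv, evenShift_single, evenShift_single]
        rw [show (2 * k + 1) / 2 = k by omega, show 2 * (n + k) + 1 = 2 * k + 1 + 2 * n by ring,
          show 2 * (n + k + 1) = 2 * k + 1 + 1 + 2 * n by ring]
  let W' : Submodule K (ℤ →₀ K) := W.comap (reindex K).symm.toLinearMap
  have hW' : ∀ n, ∀ x ∈ W', evenShift K n (connection K x) ∈ W' := by
    intro n x hx
    have h := hE n ((reindex K).symm x)
    rw [LinearEquiv.apply_symm_apply] at h
    rw [← h]
    simpa [W'] using hW n _ hx
  let S : Submodule K (ℤ →₀ K) := ⨅ n, W'.comap (evenShift K n)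
  have hS : ∀ x, x ∈ S ↔ ∀ n, evenShift K n x ∈ W' := by simp [S]
  have hSW : ∀ x ∈ S, x ∈ W' := fun x hx => by simpa [evenShift_zero] using (hS x).mp hx 0
  refine or_iff_not_imp_left.mpr fun hne => ?_
  obtain ⟨w, hw, hw0⟩ := W.ne_bot_iff.mp hne
  have hwS : connection K (reindex K w) ∈ S :=
    (hS _).mpr fun n => hW' n _ (by simpa [W'] using hw)
  have hw0' : connection K (reindex K w) ≠ 0 :=
    connection_ne_zero ((reindex K).map_ne_zero_iff.mpr hw0)
  have hTop := eq_top_of_connection_mem_of_evenShift_mem S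
    (fun x hx => (hS _).mpr fun n => hW' n x (hSW x hx))
    (fun m x hx => (hS _).mpr fun n => by
      rw [evenShift_evenShift]
      exact (hS x).mp hx _) hwS hw0'
  refine Submodule.eq_top_iff'.mpr fun x => ?_
  have h := hSW (reindex K x) (hTop ▸ Submodule.mem_top)
  simpa [W'] using h
end
end

section
/- If α ∉ (1/2)ℤ, then N(α) is irreducible as a module over the Lie algebra W_1 of vector fields on the circle: every subspace of N(α) that is invariant under the operators E_n for all n ∈ ℤ is equal to 0 or to N(α). -/
noncomputable section

/-- The basis of `N(α)` arranged in one sequence `…, v_k, u_k, v_{k+1}, u_{k+1}, …`, with `v_k` in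
degree `2 * k` and `u_k` in degree `2 * k + 1`. -/
def degreeEquiv : ℤ ≃ ℤ ⊕ ℤ where
  toFun j := if j % 2 = 0 then Sum.inl (j / 2) else Sum.inr (j / 2)
  invFun := Sum.elim (fun k => 2 * k) (fun k => 2 * k + 1)
  left_inv j := by
    dsimp only
    split_ifs <;> simp only [Sum.elim_inl, Sum.elim_inr] <;> omega
  right_inv s := by
    rcases s with k | k
    · simp
    · have h : (2 * k + 1) / 2 = k := by omega
      simp [h, Int.add_emod]

section

variable {K : Type*} [Field K]

/-- The coefficient of degree `j`, as a linear functional. -/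
def degreeCoeff (j : ℤ) : ((ℤ ⊕ ℤ) →₀ K) →ₗ[K] K := Finsupp.lapply (degreeEquiv j)

lemma degreeCoeff_single (s : ℤ ⊕ ℤ) (a : K) (j : ℤ) :
    degreeCoeff j (Finsupp.single s a) = if j = degreeEquiv.symm s then a else 0 := by
  simp only [degreeCoeff, Finsupp.lapply_apply, Finsupp.single_apply, Equiv.eq_symm_apply,
    eq_comm (a := s)]

lemma degreeCoeff_vv (k j : ℤ) : degreeCoeff j (vv K k) = if j = 2 * k then 1 else 0 :=
  (degreeCoeff_single _ _ _).trans (if_congr Iff.rfl rfl rfl)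

lemma degreeCoeff_uu (k j : ℤ) : degreeCoeff j (uu K k) = if j = 2 * k + 1 then 1 else 0 :=
  (degreeCoeff_single _ _ _).trans (if_congr Iff.rfl rfl rfl)

lemma ext_degreeCoeff {x y : (ℤ ⊕ ℤ) →₀ K} (h : ∀ j, degreeCoeff j x = degreeCoeff j y) :
    x = y := by
  ext s
  simpa [degreeCoeff] using h (degreeEquiv.symm s)

lemma exists_degreeCoeff_support (x : (ℤ ⊕ ℤ) →₀ K) :
    ∃ (d : ℤ) (w : ℕ), ∀ j, degreeCoeff j x ≠ 0 → d ≤ j ∧ j ≤ d + w := by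
  let s := x.support.map degreeEquiv.symm.toEmbedding
  have hs : ∀ j, degreeCoeff j x ≠ 0 → j ∈ s := fun j hj => by
    simpa [s, degreeCoeff, Finset.mem_map_equiv] using hj
  obtain ⟨a, ha⟩ := s.bddBelow
  obtain ⟨b, hb⟩ := s.bddAbove
  refine ⟨a, (b - a).toNat, fun j hj => ?_⟩
  have h₁ := ha (hs j hj)
  have h₂ := hb (hs j hj)
  omega

variable {α : K} {E : ℤ → (((ℤ ⊕ ℤ) →₀ K) →ₗ[K] ((ℤ ⊕ ℤ) →₀ K))}

lemma degreeCoeff_apply_of_basis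
    (hEv : ∀ n k : ℤ,
        E n (vv K k) = ((k : K) + α * n) • vv K (n + k) + uu K (n + k))
    (hEu : ∀ n k : ℤ,
        E n (uu K k) = ((k : K) + α * n) • uu K (n + k) + vv K (n + k + 1))
    (n : ℤ) (x : (ℤ ⊕ ℤ) →₀ K) (j : ℤ) :
    degreeCoeff j (E n x) =
      (((j / 2 : ℤ) : K) - n + α * n) * degreeCoeff (j - 2 * n) x
        + degreeCoeff (j - 2 * n - 1) x := by
  have key : (degreeCoeff j).comp (E n) =
      (((j / 2 : ℤ) : K) - n + α * n) • degreeCoeff (j - 2 * n)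
        + degreeCoeff (j - 2 * n - 1) := by
    refine Finsupp.lhom_ext' fun s => LinearMap.ext_ring ?_
    rcases s with k | k
    · change degreeCoeff j (E n (vv K k)) = _ * degreeCoeff _ (vv K k) + degreeCoeff _ (vv K k)
      rw [hEv]
      simp only [map_add, map_smul, degreeCoeff_vv, degreeCoeff_uu, smul_eq_mul]
      rcases eq_or_ne j (2 * (n + k)) with rfl | h₁
      · have h : 2 * (n + k) / 2 = n + k := by omega
        rw [h, if_pos rfl, if_neg (by omega), if_pos (by omega), if_neg (by omega)]
        push_cast
        ring
      · rw [if_neg h₁, if_neg (by omega : ¬ j - 2 * n = 2 * k)]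
        simp only [mul_zero, zero_add]
        exact if_congr (by omega) rfl rfl
    · change degreeCoeff j (E n (uu K k)) = _ * degreeCoeff _ (uu K k) + degreeCoeff _ (uu K k)
      rw [hEu]
      simp only [map_add, map_smul, degreeCoeff_vv, degreeCoeff_uu, smul_eq_mul]
      rcases eq_or_ne j (2 * (n + k) + 1) with rfl | h₁
      · have h : (2 * (n + k) + 1) / 2 = n + k := by omega
        rw [h, if_pos rfl, if_neg (by omega), if_pos (by omega), if_neg (by omega)]
        push_cast
        ring
      · rw [if_neg h₁, if_neg (by omega : ¬ j - 2 * n = 2 * k + 1)]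
        simp only [mul_zero, zero_add]
        exact if_congr (by omega) rfl rfl
  exact LinearMap.congr_fun key x

/-- A subspace invariant under all `E_n` is invariant under multiplication by powers of `t`,
which shifts the degree by an even number. -/
lemma exists_mem_degreeCoeff_shift [CharZero K] (h0 : α ≠ 0) (h1 : α ≠ 1)
    (hE : ∀ n x j, degreeCoeff j (E n x) =
      (((j / 2 : ℤ) : K) - n + α * n) * degreeCoeff (j - 2 * n) x
        + degreeCoeff (j - 2 * n - 1) x)
    {W : Submodule K ((ℤ ⊕ ℤ) →₀ K)} (hW : ∀ n, ∀ x ∈ W, E n x ∈ W)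
    {x : (ℤ ⊕ ℤ) →₀ K} (hx : x ∈ W) (l : ℤ) :
    ∃ y ∈ W, ∀ j, degreeCoeff j y = degreeCoeff (j - 2 * l) x := by
  have hc : 2 * (α - α ^ 2) ≠ 0 := by
    have : 2 * (α - α ^ 2) = 2 * (α * (1 - α)) := by ring
    rw [this]
    exact mul_ne_zero two_ne_zero (mul_ne_zero h0 (sub_ne_zero.mpr h1.symm))
  refine ⟨(2 * (α - α ^ 2))⁻¹ •
    (E (l - 1) (E 1 x) + E (l + 1) (E (-1) x) - (2 : K) • E l (E 0 x)), ?_, fun j => ?_⟩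
  · exact W.smul_mem _ (W.sub_mem (W.add_mem (hW _ _ (hW _ _ hx)) (hW _ _ (hW _ _ hx)))
      (W.smul_mem _ (hW _ _ (hW _ _ hx))))
  · rw [map_smul, smul_eq_mul, inv_mul_eq_iff_eq_mul₀ hc]
    have half (i m : ℤ) : (((i - 2 * m) / 2 : ℤ) : K) = ((i / 2 : ℤ) : K) - m := by
      rw [← Int.cast_sub]
      congr 1
      omega
    have e₁ : j - 2 * (l - 1) - 2 * 1 = j - 2 * l := by ring
    have e₂ : j - 2 * (l + 1) - 2 * -1 = j - 2 * l := by ring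
    have e₃ : j - 2 * (l - 1) - 1 = j - 1 - 2 * (l - 1) := by ring
    have e₄ : j - 2 * (l + 1) - 1 = j - 1 - 2 * (l + 1) := by ring
    have e₅ : j - 2 * l - 1 = j - 1 - 2 * l := by ring
    have e₆ : j - 1 - 2 * (l - 1) - 2 * 1 = j - 1 - 2 * l := by ring
    have e₇ : j - 1 - 2 * (l + 1) - 2 * -1 = j - 1 - 2 * l := by ring
    simp only [map_add, map_sub, map_smul, smul_eq_mul, hE, mul_zero, sub_zero, e₁, e₂, e₃, e₄,
      e₅, e₆, e₇, half]
    push_cast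
    ring

lemma exists_single_mem [CharZero K] (h0 : α ≠ 0) (h1 : α ≠ 1)
    (hE : ∀ n x j, degreeCoeff j (E n x) =
      (((j / 2 : ℤ) : K) - n + α * n) * degreeCoeff (j - 2 * n) x
        + degreeCoeff (j - 2 * n - 1) x)
    {W : Submodule K ((ℤ ⊕ ℤ) →₀ K)} (hW : ∀ n, ∀ x ∈ W, E n x ∈ W) (w : ℕ) :
    ∀ x ∈ W, x ≠ 0 → ∀ d : ℤ, (∀ j, degreeCoeff j x ≠ 0 → d ≤ j ∧ j ≤ d + w) →
      ∃ i : ℤ, Finsupp.single (degreeEquiv i) (1 : K) ∈ W := by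
  induction w with
  | zero =>
    intro x hx hx0 d hd
    have hxd : x = degreeCoeff d x • Finsupp.single (degreeEquiv d) (1 : K) := by
      refine ext_degreeCoeff fun j => ?_
      rw [map_smul, degreeCoeff_single, Equiv.symm_apply_apply]
      split_ifs with h
      · simp [h]
      · rw [smul_zero]
        by_contra hj
        have := hd j hj
        push_cast at this
        omega
    have hne : degreeCoeff d x ≠ 0 := fun h => hx0 (by rw [hxd, h, zero_smul])
    refine ⟨d, ?_⟩
    rw [hxd] at hx
    exact (W.smul_mem_iff hne).mp hx
  | succ w ih =>
    intro x hx hx0 d hd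
    by_cases htop : degreeCoeff (d + w + 1) x = 0
    · refine ih x hx hx0 d fun j hj => ?_
      have := hd j hj
      have hne : j ≠ d + w + 1 := fun h => hj (h ▸ htop)
      push_cast at this
      omega
    obtain ⟨y, hy, hyx⟩ := exists_mem_degreeCoeff_shift h0 h1 hE hW hx 1
    -- With `A = E_0`, this is `(A - ⌊(d+1)/2⌋) (A - ⌊d/2⌋) x - t x`.
    let z := E 0 (E 0 x) - (d : K) • E 0 x
      + (((d / 2 : ℤ) : K) * (((d + 1) / 2 : ℤ) : K)) • x - y
    have hzW : z ∈ W := W.sub_mem (W.add_mem (W.sub_mem (hW _ _ (hW _ _ hx))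
      (W.smul_mem _ (hW _ _ hx))) (W.smul_mem _ hx)) hy
    have floor_add (i : ℤ) : (i : K) = ((i / 2 : ℤ) : K) + (((i + 1) / 2 : ℤ) : K) := by
      rw [← Int.cast_add]
      congr 1
      omega
    have hz (j : ℤ) : degreeCoeff j z =
        (((j / 2 : ℤ) : K) - (((d + 1) / 2 : ℤ) : K)) * (((j / 2 : ℤ) : K) - ((d / 2 : ℤ) : K))
          * degreeCoeff j x + ((j : K) - 1 - d) * degreeCoeff (j - 1) x := by
      have hj := floor_add (j - 1)
      rw [sub_add_cancel] at hj
      push_cast at hj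
      have e : j - 1 - 1 = j - 2 := by ring
      simp only [z, map_add, map_sub, map_smul, smul_eq_mul, hE, hyx, mul_zero, mul_one, sub_zero,
        Int.cast_zero, add_zero, e]
      rw [hj, floor_add d]
      ring
    refine ih z hzW ?_ (d + 2) fun j hj => ?_
    · intro h
      have h' := hz (d + w + 2)
      have e : d + w + 2 - 1 = d + (w : ℤ) + 1 := by ring
      have hout : degreeCoeff (d + w + 2) x = 0 := by
        by_contra hne
        have := hd _ hne
        push_cast at this
        omega
      rw [h, map_zero, hout, mul_zero, zero_add, e] at h'
      refine mul_ne_zero ?_ htop h'.symm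
      push_cast
      have : (d : K) + w + 2 - 1 - d = ((w + 1 : ℕ) : K) := by
        push_cast
        ring
      rw [this]
      exact Nat.cast_ne_zero.mpr w.succ_ne_zero
    · by_contra hout
      apply hj
      rw [hz]
      have hzero (i : ℤ) (hi : ¬ (d ≤ i ∧ i ≤ d + w + 1)) : degreeCoeff i x = 0 := by
        by_contra hne
        have := hd _ hne
        push_cast at this
        omega
      rcases eq_or_ne j d with rfl | hjd
      · rw [hzero (j - 1) (by omega)]
        ring
      rcases eq_or_ne j (d + 1) with rfl | hjd'
      · push_cast
        ring
      · rw [hzero j (by omega), hzero (j - 1) (by omega)]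
        ring

lemma eq_top_of_single_mem [CharZero K] (h0 : α ≠ 0) (h1 : α ≠ 1)
    (hE : ∀ n x j, degreeCoeff j (E n x) =
      (((j / 2 : ℤ) : K) - n + α * n) * degreeCoeff (j - 2 * n) x
        + degreeCoeff (j - 2 * n - 1) x)
    {W : Submodule K ((ℤ ⊕ ℤ) →₀ K)} (hW : ∀ n, ∀ x ∈ W, E n x ∈ W) {i : ℤ}
    (hi : Finsupp.single (degreeEquiv i) (1 : K) ∈ W) : W = ⊤ := by
  have shift {i : ℤ} (hi : Finsupp.single (degreeEquiv i) (1 : K) ∈ W) (l : ℤ) :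
      Finsupp.single (degreeEquiv (i + 2 * l)) (1 : K) ∈ W := by
    obtain ⟨y, hy, hyx⟩ := exists_mem_degreeCoeff_shift h0 h1 hE hW hi l
    convert hy using 1
    refine ext_degreeCoeff fun j => ?_
    rw [hyx, degreeCoeff_single, degreeCoeff_single, Equiv.symm_apply_apply,
      Equiv.symm_apply_apply]
    exact if_congr (by omega) rfl rfl
  have hi' : Finsupp.single (degreeEquiv (i + 1)) (1 : K) ∈ W := by
    convert W.sub_mem (hW 0 _ hi) (W.smul_mem ((i / 2 : ℤ) : K) hi) using 1
    refine ext_degreeCoeff fun j => ?_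
    simp only [map_sub, map_smul, hE, degreeCoeff_single, Equiv.symm_apply_apply, mul_zero,
      sub_zero, Int.cast_zero, add_zero, smul_eq_mul]
    rcases eq_or_ne j i with rfl | h
    · simp
    · rw [if_neg h, mul_zero, mul_zero, zero_add, sub_zero]
      exact if_congr (by omega) rfl rfl
  have hall (j : ℤ) : Finsupp.single (degreeEquiv j) (1 : K) ∈ W := by
    rcases Int.emod_two_eq_zero_or_one (j - i) with h | h
    · convert shift hi ((j - i) / 2) using 3
      omega
    · convert shift hi' ((j - i) / 2) using 3
      omega
  refine Submodule.eq_top_iff'.mpr fun x => ?_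
  induction x using Finsupp.induction_linear with
  | zero => exact W.zero_mem
  | add f g hf hg => exact W.add_mem hf hg
  | single s a =>
    have := W.smul_mem a (hall (degreeEquiv.symm s))
    rwa [Equiv.apply_symm_apply, Finsupp.smul_single, smul_eq_mul, mul_one] at this

end


/-- If `α ∉ (1/2)ℤ`, then `N(α)` is irreducible as a module over the Lie algebra
`W_1` of vector fields on the circle: every subspace invariant under all the
operators `E_n`, `n ∈ ℤ`, is `0` or `N(α)`. -/
theorem Nalpha_W1_irreducible (K : Type*) [Field K] [CharZero K] [IsAlgClosed K]
    (α : K) (hα : ∀ m : ℤ, α ≠ (m : K) / 2)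
    (E : ℤ → (((ℤ ⊕ ℤ) →₀ K) →ₗ[K] ((ℤ ⊕ ℤ) →₀ K)))
    (hEv : ∀ n k : ℤ,
        E n (vv K k) = ((k : K) + α * n) • vv K (n + k) + uu K (n + k))
    (hEu : ∀ n k : ℤ,
        E n (uu K k) = ((k : K) + α * n) • uu K (n + k) + vv K (n + k + 1)) :
    ∀ W : Submodule K ((ℤ ⊕ ℤ) →₀ K),
      (∀ n : ℤ, ∀ x ∈ W, E n x ∈ W) → W = ⊥ ∨ W = ⊤ := by
  intro W hW
  have h0 : α ≠ 0 := by simpa using hα 0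
  have h1 : α ≠ 1 := by simpa using hα 2
  have hE := degreeCoeff_apply_of_basis hEv hEu
  refine or_iff_not_imp_left.mpr fun hbot => ?_
  obtain ⟨x, hx, hx0⟩ := W.ne_bot_iff.mp hbot
  obtain ⟨d, w, hd⟩ := exists_degreeCoeff_support x
  obtain ⟨i, hi⟩ := exists_single_mem h0 h1 hE hW w x hx hx0 d hd
  exact eq_top_of_single_mem h0 h1 hE hW hi
end
end
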